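/- Let Δ be a fundamental discriminant and r ∈ ℤ with Δ ≡ r² (mod 4N). For h ∈ L'/L and λ ∈ L'/ΔL, the exponential sum G_h(λ,Δ,r) = Σ_{λ' ∈ L'/ΔL, λ' ≡ rh (mod L), Q(λ') ≡ ΔQ(h) (mod Δ)} χ_Δ(λ') e(−(λ,λ')/|Δ|) equals ε|Δ|^{3/2} χ_Δ(λ) Σ_{h' ∈ L'/L, λ ≡ rh' (mod L), Q(λ) ≡ ΔQ(h') (mod Δ)} e(−sgn(Δ)(h,h')), where ε = 1 if Δ > 0 and ε = i if Δ < 0. -/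

import Mathlib

noncomputable section

open Complex
open scoped Classical Manifold

/-- `e(x) = exp(2πix)`. -/
def e (x : ℂ) : ℂ := Complex.exp (2 * (Real.pi : ℂ) * Complex.I * x)

/-- `D` is a fundamental discriminant: either `D ≡ 1 (mod 4)` and squarefree, or
`D = 4m` with `m ≡ 2, 3 (mod 4)` squarefree. -/
def IsFundamentalDiscriminant (D : ℤ) : Prop :=
  (D % 4 = 1 ∧ Squarefree D) ∨
    (D % 4 = 0 ∧ Squarefree (D / 4) ∧ (D / 4 % 4 = 2 ∨ D / 4 % 4 = 3))

/-- The Kronecker symbol `(a/2)`. -/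
def kron2 (a : ℤ) : ℤ :=
  if a % 2 = 0 then 0 else if a % 8 = 1 ∨ a % 8 = 7 then 1 else -1

/-- The Kronecker symbol `(a/n)`, extending the Jacobi symbol to arbitrary integers `n`. -/
def kronecker (a n : ℤ) : ℤ :=
  if n = 0 then (if a = 1 ∨ a = -1 then 1 else 0)
  else
    (if n < 0 ∧ a < 0 then -1 else 1) * kron2 a ^ n.natAbs.factorization 2 *
      jacobiSym a (n.natAbs / 2 ^ n.natAbs.factorization 2)

/-- The discriminant `b² - 4Nac` of the integral binary quadratic form `[a, b, Nc]`
corresponding to the lattice vector `λ = [[b/2N, -a/N], [c, -b/2N]] ∈ L'`;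
note `Q(λ) = (b² - 4Nac)/(4N)`. -/
def QD (N : ℕ) (a b c : ℤ) : ℤ := b ^ 2 - 4 * (N : ℤ) * a * c

/-- The condition under which the generalized genus character `χ_Δ` is non-zero at `[a, b, Nc]`:
`Δ ∣ b² - 4Nac`, `(b² - 4Nac)/Δ` is a square modulo `4N`, and `gcd(a, b, c, Δ) = 1`. -/
def GenusCharCond (N : ℕ) (Δ a b c : ℤ) : Prop :=
  Δ ∣ QD N a b c ∧ (∃ s : ℤ, QD N a b c / Δ ≡ s ^ 2 [ZMOD (4 * (N : ℤ))]) ∧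
    Int.gcd (Int.gcd (Int.gcd a b) c) Δ = 1

/-- `χ` (with `χ a b c` meaning `χ_Δ` applied to the vector of `L'` corresponding to the
binary quadratic form `[a, b, Nc]`) is the generalized genus character `χ_Δ` of
Gross–Kohnen–Zagier: it only depends on the argument modulo `ΔL`, it vanishes unless
`GenusCharCond` holds, and in that case it equals the Kronecker symbol `(Δ/n)` for any
integer `n` prime to `Δ` represented by one of the forms `[N₁a, b, N₂c]` with
`N₁N₂ = N`, `N₁, N₂ > 0`. -/
def IsGenusChar (N : ℕ) (Δ : ℤ) (χ : ℤ → ℤ → ℤ → ℤ) : Prop :=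
  (∀ a b c a' b' c' : ℤ,
      a ≡ a' [ZMOD Δ] → b ≡ b' [ZMOD (2 * (N : ℤ) * Δ)] → c ≡ c' [ZMOD Δ] →
      χ a b c = χ a' b' c') ∧
  (∀ a b c : ℤ, ¬ GenusCharCond N Δ a b c → χ a b c = 0) ∧
  (∀ a b c n : ℤ, GenusCharCond N Δ a b c → Int.gcd n Δ = 1 →
      (∃ N₁ N₂ x y : ℤ, N₁ * N₂ = (N : ℤ) ∧ 0 < N₁ ∧ 0 < N₂ ∧
        n = N₁ * a * x ^ 2 + b * x * y + N₂ * c * y ^ 2) →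
      χ a b c = kronecker Δ n)

/-- The Gaussian binomial coefficients, defined by the `q`-Pascal rule. -/
def qBinom (q : ℂ) : ℕ → ℕ → ℂ
  | _, 0 => 1
  | 0, _ + 1 => 0
  | m + 1, j + 1 => qBinom q m j + q ^ (j + 1) * qBinom q m (j + 1)

lemma qBinom_zero_right (q : ℂ) (m : ℕ) : qBinom q m 0 = 1 := by
  cases m <;> rfl

lemma qBinom_eq_zero (q : ℂ) : ∀ m j : ℕ, m < j → qBinom q m j = 0
  | _, 0, h => absurd h (Nat.not_lt_zero _)
  | 0, j + 1, _ => rfl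
  | m + 1, j + 1, h => by
      rw [qBinom, qBinom_eq_zero q m j (by omega), qBinom_eq_zero q m (j + 1) (by omega)]
      simp

lemma qBinom_succ_right (q : ℂ) : ∀ m j : ℕ,
    q ^ j * (1 - q ^ (j + 1)) * qBinom q m (j + 1) = (q ^ j - q ^ m) * qBinom q m j
  | 0, 0 => by simp [qBinom]
  | 0, j + 1 => by simp [qBinom]
  | m + 1, 0 => by
      have h := qBinom_succ_right q m 0
      simp only [qBinom, qBinom_zero_right] at h ⊢
      linear_combination q * h
  | m + 1, j + 1 => by
      have h0 := qBinom_succ_right q m j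
      have h1 := qBinom_succ_right q m (j + 1)
      rw [qBinom, qBinom]
      linear_combination q ^ (j + 2) * h1 + q * h0

lemma qBinom_succ_succ' (q : ℂ) (m j : ℕ) :
    q ^ j * qBinom q (m + 1) (j + 1) = q ^ m * qBinom q m j + q ^ j * qBinom q m (j + 1) := by
  rw [qBinom]
  linear_combination -qBinom_succ_right q m j

/-- The alternating sum of Gaussian binomial coefficients. -/
def qAlt (q : ℂ) (m : ℕ) : ℂ := ∑ j ∈ Finset.range (m + 1), (-1) ^ j * qBinom q m j

/-- The alternating sum of Gaussian binomial coefficients weighted by `q ^ j`. -/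
def qAlt' (q : ℂ) (m : ℕ) : ℂ := ∑ j ∈ Finset.range (m + 1), (-1) ^ j * q ^ j * qBinom q m j

lemma qAlt_succ (q : ℂ) (m : ℕ) : qAlt q (m + 1) = qAlt' q m - qAlt q m := by
  have h : qAlt' q m = ∑ j ∈ Finset.range (m + 1 + 1), (-1) ^ j * q ^ j * qBinom q m j := by
    rw [Finset.sum_range_succ, qBinom_eq_zero q m (m + 1) (by omega), qAlt']
    simp
  rw [h, qAlt, qAlt, Finset.sum_range_succ', Finset.sum_range_succ' _ (m + 1), qBinom_zero_right,
    qBinom_zero_right, add_sub_right_comm, ← Finset.sum_sub_distrib]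
  congr 1
  · refine Finset.sum_congr rfl fun j _ => ?_
    rw [qBinom]
    ring
  · simp

lemma qAlt'_succ (q : ℂ) (m : ℕ) :
    qAlt' q (m + 1) = qAlt' q m - q ^ (m + 1) * qAlt q m := by
  have h : qAlt' q m = ∑ j ∈ Finset.range (m + 1 + 1), (-1) ^ j * q ^ j * qBinom q m j := by
    rw [Finset.sum_range_succ, qBinom_eq_zero q m (m + 1) (by omega), qAlt']
    simp
  rw [h, qAlt', qAlt, Finset.sum_range_succ', Finset.sum_range_succ' _ (m + 1), qBinom_zero_right,
    qBinom_zero_right, add_sub_right_comm, Finset.mul_sum, ← Finset.sum_sub_distrib]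
  congr 1
  refine Finset.sum_congr rfl fun j _ => ?_
  linear_combination (-1) ^ (j + 1) * q * qBinom_succ_succ' q m j

/-- Gauss's product formula for the alternating sum of Gaussian binomial coefficients. -/
lemma qAlt_two_mul (q : ℂ) (M : ℕ) :
    qAlt q (2 * M) = ∏ i ∈ Finset.range M, (1 - q ^ (2 * i + 1)) := by
  induction M with
  | zero => simp [qAlt, qBinom]
  | succ M ih =>
    rw [Finset.prod_range_succ, ← ih, show 2 * (M + 1) = 2 * M + 1 + 1 by ring, qAlt_succ,
      qAlt'_succ, qAlt_succ]
    ring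

lemma qBinom_of_primitiveRoot {n : ℕ} {q : ℂ} (hq : IsPrimitiveRoot q (n + 1)) :
    ∀ j : ℕ, j ≤ n → q ^ (j * (j + 1) / 2) * qBinom q n j = (-1) ^ j
  | 0, _ => by simp [qBinom_zero_right]
  | j + 1, hj => by
      have hq0 : q ≠ 0 := hq.ne_zero (by omega)
      have ih := qBinom_of_primitiveRoot hq j (by omega)
      have h1 : 1 - q ^ (j + 1) ≠ 0 := fun h =>
        hq.pow_ne_one_of_pos_of_lt (by omega) (by omega) (sub_eq_zero.mp h).symm
      have h2 := qBinom_succ_right q n j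
      have h3 : q ^ n * q = 1 := by rw [← pow_succ, hq.pow_eq_one]
      have h4 : (j + 1) * (j + 1 + 1) / 2 = j * (j + 1) / 2 + (j + 1) := by
        rw [show (j + 1) * (j + 1 + 1) = j * (j + 1) + (j + 1) * 2 by ring,
          Nat.add_mul_div_right _ _ (by norm_num)]
      have h5 : (1 - q ^ (j + 1)) * (q ^ (j + 1) * qBinom q n (j + 1) + qBinom q n j) = 0 := by
        linear_combination q * h2 - qBinom q n j * h3
      have h6 := (mul_eq_zero.mp h5).resolve_left h1
      rw [h4, pow_add, pow_succ (-1 : ℂ), ← ih]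
      linear_combination q ^ (j * (j + 1) / 2) * h6

lemma sum_triangular_pow {M : ℕ} {q : ℂ} (hq : IsPrimitiveRoot q (2 * M + 1)) :
    ∑ j ∈ Finset.range (2 * M + 1), (q⁻¹) ^ (j * (j + 1) / 2) =
      ∏ i ∈ Finset.range M, (1 - q ^ (2 * i + 1)) := by
  rw [← qAlt_two_mul, qAlt]
  refine Finset.sum_congr rfl fun j hj => ?_
  have h := qBinom_of_primitiveRoot hq j (by simp at hj; omega)
  have h2 : (-1 : ℂ) ^ j * (-1) ^ j = 1 := by rw [← mul_pow]; simp
  rw [inv_pow]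
  exact inv_eq_of_mul_eq_one_right (by linear_combination (-1 : ℂ) ^ j * h + h2)

lemma e_add (x y : ℂ) : e (x + y) = e x * e y := by
  rw [e, e, e, ← Complex.exp_add]
  ring_nf

lemma e_intCast (n : ℤ) : e n = 1 := by
  rw [e, ← Complex.exp_int_mul_two_pi_mul_I n]
  ring_nf

lemma e_zero : e 0 = 1 := by simpa using e_intCast 0

lemma e_natCast_mul (n : ℕ) (x : ℂ) : e (n * x) = e x ^ n := by
  rw [e, e, ← Complex.exp_nat_mul]
  ring_nf

lemma stdAddChar_intCast (D : ℕ) [NeZero D] (j : ℤ) :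
    ZMod.stdAddChar (j : ZMod D) = e ((j : ℂ) / D) := by
  rw [ZMod.stdAddChar_coe, e]
  ring_nf

lemma Function.Periodic.eq_of_intModEq {f : ℤ → ℂ} {m : ℤ} (hf : Function.Periodic f m) {x y : ℤ}
    (h : x ≡ y [ZMOD m]) : f x = f y := by
  obtain ⟨k, hk⟩ := h.dvd
  have h2 := hf.int_mul k x
  rw [← h2]
  congr 1
  simp only [Int.cast_id]
  linarith

lemma sum_range_eq_sum_zmod (m : ℕ) [NeZero m] (F : ZMod m → ℂ) :
    ∑ x ∈ Finset.range m, F (x : ZMod m) = ∑ z, F z := by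
  refine Finset.sum_bij' (fun x _ => (x : ZMod m)) (fun z _ => z.val) (by simp) ?_ ?_ ?_ (by simp)
  · intro z _
    simpa using ZMod.val_lt z
  · intro x hx
    exact ZMod.val_cast_of_lt (by simpa using hx)
  · intro z _
    simp

lemma Function.Periodic.sum_range_eq {f : ℤ → ℂ} {m : ℕ} [NeZero m]
    (hf : Function.Periodic f m) :
    ∑ x ∈ Finset.range m, f x = ∑ z : ZMod m, f z.val := by
  rw [← sum_range_eq_sum_zmod]
  refine Finset.sum_congr rfl fun x _ => hf.eq_of_intModEq ?_
  rw [← ZMod.intCast_eq_intCast_iff]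
  simp

lemma Function.Periodic.sum_range_add {f : ℤ → ℂ} {m : ℕ} [NeZero m]
    (hf : Function.Periodic f m) (s : ℤ) :
    ∑ x ∈ Finset.range m, f (x + s) = ∑ x ∈ Finset.range m, f x := by
  have hg : Function.Periodic (fun x => f (x + s)) (m : ℤ) := fun x => by
    change f (x + m + s) = f (x + s)
    rw [add_right_comm, hf]
  rw [hf.sum_range_eq, hg.sum_range_eq]
  refine Fintype.sum_equiv (Equiv.addRight (s : ZMod m)) _ _ fun z => hf.eq_of_intModEq ?_
  rw [← ZMod.intCast_eq_intCast_iff]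
  simp

lemma isPrimitiveRoot_e (n : ℕ) (hn : n ≠ 0) : IsPrimitiveRoot (e (1 / n)) n := by
  rw [e]
  convert Complex.isPrimitiveRoot_exp n hn using 2
  ring

/-- The quadratic Gauss sum of odd order `n = 2 * M + 1` as a product. -/
lemma sum_sq_eq_prod (M : ℕ) :
    ∑ x ∈ Finset.range (2 * M + 1), e ((x : ℂ) ^ 2 / (2 * M + 1 : ℕ)) =
      ∏ i ∈ Finset.range M, (e ((2 * i + 1) / (2 * M + 1 : ℕ)) -
        e (-(2 * i + 1) / (2 * M + 1 : ℕ))) := by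
  set n : ℕ := 2 * M + 1 with hn
  have hn0 : (n : ℂ) ≠ 0 := by
    exact Nat.cast_ne_zero.mpr (by omega)
  have : NeZero n := ⟨by omega⟩
  have hω := isPrimitiveRoot_e n (by omega)
  have hω2 : IsPrimitiveRoot ((e (1 / n) ^ 2)⁻¹) n :=
    (hω.pow_of_coprime 2 (by rw [hn]; simp)).inv
  have hT := sum_triangular_pow hω2
  have hper : Function.Periodic (fun x : ℤ => e ((x : ℂ) ^ 2 / n)) (n : ℤ) := fun x => by
    have : ((x + n : ℤ) : ℂ) ^ 2 / n = (x : ℂ) ^ 2 / n + ((2 * x + n : ℤ) : ℂ) := by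
      push_cast; field_simp; ring
    change e (((x + n : ℤ) : ℂ) ^ 2 / n) = _
    rw [this, e_add, e_intCast, mul_one]
  have h1 : ∑ x ∈ Finset.range n, e ((x : ℂ) ^ 2 / n) =
      e ((M : ℂ) ^ 2 / n) * ∑ j ∈ Finset.range n, (((e (1 / n) ^ 2)⁻¹)⁻¹) ^ (j * (j + 1) / 2) := by
    have h := hper.sum_range_add (M + 1)
    simp only [Int.cast_natCast] at h
    rw [← h, Finset.mul_sum]
    refine Finset.sum_congr rfl fun j _ => ?_
    rw [inv_inv, ← pow_mul, Nat.mul_div_cancel' (Nat.even_mul_succ_self j).two_dvd,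
      ← e_natCast_mul, ← e_add]
    have : (((j : ℤ) + (M + 1) : ℤ) : ℂ) ^ 2 / n =
        (M : ℂ) ^ 2 / n + ((j * (j + 1) : ℕ) : ℂ) * (1 / n) + ((j + 1 : ℤ) : ℂ) := by
      have hnM : (n : ℂ) = 2 * M + 1 := by rw [hn]; push_cast; ring
      push_cast
      field_simp
      rw [hnM]
      ring
    rw [this, e_add _ ((j + 1 : ℤ) : ℂ), e_intCast, mul_one]
  have h2 : ∀ K : ℕ, e ((K : ℂ) ^ 2 / n) = ∏ i ∈ Finset.range K, e ((2 * i + 1) / n) := by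
    intro K
    induction K with
    | zero => simp [e_zero]
    | succ K ih =>
      rw [Finset.prod_range_succ, ← ih, ← e_add]
      congr 1
      push_cast
      ring
  rw [h1, hT, h2, ← Finset.prod_mul_distrib]
  refine Finset.prod_congr rfl fun i _ => ?_
  have h3 : e ((2 * i + 1) / n) = e (1 / n) ^ (2 * i + 1) := by
    rw [← e_natCast_mul]
    congr 1
    push_cast
    ring
  have h4 : e ((2 * i + 1) / n) * e (-(2 * i + 1) / n) = 1 := by
    rw [← e_add, ← e_zero]
    congr 1
    ring
  have h5 : e (-(2 * i + 1) / n) = (e (1 / n) ^ (2 * i + 1))⁻¹ := by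
    rw [← h3]
    exact (inv_eq_of_mul_eq_one_right h4).symm
  rw [h5, h3, inv_pow, ← pow_mul, mul_comm 2 (2 * i + 1), pow_mul]
  have h6 : e (1 / (n : ℂ)) ^ (2 * i + 1) ≠ 0 := pow_ne_zero _ (hω.ne_zero (by omega))
  field_simp

open scoped NumberTheorySymbols

lemma Function.Periodic.sum_mul_eq {A B : ℕ} [NeZero A] [NeZero B] (hAB : A.Coprime B) {F : ℤ → ℂ}
    (hF : Function.Periodic F (A * B : ℕ)) :
    ∑ n ∈ Finset.range (A * B), F n =
      ∑ x ∈ Finset.range A, ∑ y ∈ Finset.range B, F (x * B + y * A) := by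
  have : NeZero (A * B) := ⟨mul_ne_zero (NeZero.ne A) (NeZero.ne B)⟩
  have hinj : Function.Injective (fun z : ZMod A × ZMod B =>
      ((z.1.val * B + z.2.val * A : ℕ) : ZMod (A * B))) := by
    intro z w h
    have h' : z.1.val * B + z.2.val * A ≡ w.1.val * B + w.2.val * A [MOD A * B] :=
      (ZMod.natCast_eq_natCast_iff _ _ _).mp h
    have h1 : z.1.val * B + z.2.val * A ≡ w.1.val * B + w.2.val * A [MOD A] :=
      h'.of_dvd (dvd_mul_right A B)
    have h2 : z.1.val * B + z.2.val * A ≡ w.1.val * B + w.2.val * A [MOD B] :=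
      h'.of_dvd (dvd_mul_left B A)
    have e1 := (ZMod.natCast_eq_natCast_iff _ _ _).mpr h1
    have e2 := (ZMod.natCast_eq_natCast_iff _ _ _).mpr h2
    push_cast at e1 e2
    simp only [CharP.cast_eq_zero, mul_zero, add_zero, zero_add, ZMod.natCast_val,
      ZMod.cast_id', id_eq] at e1 e2
    exact Prod.ext ((ZMod.unitOfCoprime B hAB.symm).isUnit.mul_left_injective e1)
      ((ZMod.unitOfCoprime A hAB).isUnit.mul_left_injective e2)
  have hbij := (Fintype.bijective_iff_injective_and_card _).mpr
    ⟨hinj, by simp [ZMod.card]⟩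
  have hper : ∀ (x y : ℕ), (x : ZMod (A * B)) = y → F x = F y := fun x y h =>
    hF.eq_of_intModEq ((ZMod.intCast_eq_intCast_iff _ _ _).mp (by exact_mod_cast h))
  rw [hF.sum_range_eq, ← hbij.sum_comp, Fintype.sum_prod_type]
  rw [← sum_range_eq_sum_zmod A]
  refine Finset.sum_congr rfl fun x hx => ?_
  rw [← sum_range_eq_sum_zmod B]
  refine Finset.sum_congr rfl fun y hy => ?_
  simp only [ZMod.val_cast_of_lt (Finset.mem_range.mp hx),
    ZMod.val_cast_of_lt (Finset.mem_range.mp hy)]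
  have := hper (((x * B + y * A : ℕ) : ZMod (A * B)).val) (x * B + y * A) (by simp)
  rw [this]
  push_cast
  rfl

/-- `f` is a real primitive Dirichlet character modulo `m`, as a function on integers. -/
structure IsRealPrimitiveChar (m : ℕ) (f : ℤ → ℤ) : Prop where
  congr : ∀ x y, x ≡ y [ZMOD m] → f x = f y
  mul : ∀ x y, f (x * y) = f x * f y
  zero : ∀ x, Int.gcd x m ≠ 1 → f x = 0
  sq : ∀ x, Int.gcd x m = 1 → f x = 1 ∨ f x = -1
  prim : ∀ p : ℕ, p.Prime → p ∣ m → ∃ u : ℤ, u ≡ 1 [ZMOD (m / p : ℕ)] ∧ f u = -1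

/-- The Gauss sum of a function of period `m`. -/
def charGaussSum (m : ℕ) (f : ℤ → ℤ) : ℂ := ∑ x ∈ Finset.range m, (f x : ℂ) * e (x / m)

lemma IsRealPrimitiveChar.one {m : ℕ} {f : ℤ → ℤ} (hf : IsRealPrimitiveChar m f) : f 1 = 1 := by
  have h := hf.mul 1 1
  rcases hf.sq 1 (by simp) with h1 | h1
  · exact h1
  · rw [mul_one, h1] at h; norm_num at h

lemma exists_modEq_and_modEq {A B : ℕ} (hAB : A.Coprime B) (x y : ℤ) :
    ∃ z : ℤ, z ≡ x [ZMOD A] ∧ z ≡ y [ZMOD B] := by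
  have h := Int.gcd_eq_gcd_ab A B
  rw [Int.gcd_natCast_natCast, hAB] at h
  push_cast at h
  refine ⟨x * (B * Int.gcdB A B) + y * (A * Int.gcdA A B), ?_, ?_⟩
  · refine (Int.modEq_iff_dvd.mpr ⟨x * Int.gcdA A B - y * Int.gcdA A B, ?_⟩)
    linear_combination x * h
  · refine (Int.modEq_iff_dvd.mpr ⟨y * Int.gcdB A B - x * Int.gcdB A B, ?_⟩)
    linear_combination y * h

lemma isRealPrimitiveChar_one : IsRealPrimitiveChar 1 (fun _ => 1) where
  congr _ _ _ := rfl
  mul _ _ := rfl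
  zero x h := absurd (by simp) h
  sq _ _ := Or.inl rfl
  prim p hp h := absurd (Nat.dvd_one.mp h) hp.one_lt.ne'

lemma IsRealPrimitiveChar.mul_char {A B : ℕ} {f g : ℤ → ℤ} (hf : IsRealPrimitiveChar A f)
    (hg : IsRealPrimitiveChar B g) (hAB : A.Coprime B) :
    IsRealPrimitiveChar (A * B) (fun x => f x * g x) where
  congr x y h := by
    rw [hf.congr x y (h.of_dvd (by push_cast; exact dvd_mul_right _ _)),
      hg.congr x y (h.of_dvd (by push_cast; exact dvd_mul_left _ _))]
  mul x y := by
    rw [hf.mul, hg.mul]; ring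
  zero x h := by
    by_cases hA : Int.gcd x A = 1
    · rw [hg.zero x, mul_zero]
      intro hB
      refine h ?_
      rw [← Int.isCoprime_iff_gcd_eq_one] at hA hB ⊢
      push_cast
      exact hA.mul_right hB
    · rw [hf.zero x hA, zero_mul]
  sq x h := by
    rw [← Int.isCoprime_iff_gcd_eq_one] at h
    push_cast at h
    rcases hf.sq x (Int.isCoprime_iff_gcd_eq_one.mp h.of_mul_right_left) with h1 | h1 <;>
    rcases hg.sq x (Int.isCoprime_iff_gcd_eq_one.mp h.of_mul_right_right) with h2 | h2 <;>
    simp [h1, h2]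
  prim p hp h := by
    rcases hp.dvd_mul.mp h with h | h
    · obtain ⟨u, hu, hu'⟩ := hf.prim p hp h
      obtain ⟨z, hz, hz'⟩ := exists_modEq_and_modEq hAB u 1
      refine ⟨z, ?_, ?_⟩
      · obtain ⟨A', rfl⟩ := h
        rw [mul_assoc, Nat.mul_div_cancel_left _ hp.pos]
        rw [Nat.mul_div_cancel_left _ hp.pos] at hu
        push_cast
        refine (Int.modEq_and_modEq_iff_modEq_mul ?_).mp ⟨?_, hz'⟩
        · simpa using hAB.coprime_mul_left
        · exact ((hz.of_dvd (by push_cast; exact dvd_mul_left _ _)).trans hu)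
      · rw [hf.congr _ _ hz, hg.congr _ _ hz', hu', hg.one]; rfl
    · obtain ⟨u, hu, hu'⟩ := hg.prim p hp h
      obtain ⟨z, hz, hz'⟩ := exists_modEq_and_modEq hAB 1 u
      refine ⟨z, ?_, ?_⟩
      · obtain ⟨B', rfl⟩ := h
        rw [mul_left_comm, Nat.mul_div_cancel_left _ hp.pos]
        rw [Nat.mul_div_cancel_left _ hp.pos] at hu
        push_cast
        refine (Int.modEq_and_modEq_iff_modEq_mul ?_).mp ⟨hz, ?_⟩
        · simpa using hAB.coprime_mul_left_right
        · exact ((hz'.of_dvd (by push_cast; exact dvd_mul_left _ _)).trans hu)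
      · rw [hf.congr _ _ hz, hg.congr _ _ hz', hu', hf.one]; rfl

lemma charGaussSum_mul {A B : ℕ} [NeZero A] [NeZero B] {f g : ℤ → ℤ}
    (hf : IsRealPrimitiveChar A f) (hg : IsRealPrimitiveChar B g) (hAB : A.Coprime B) :
    charGaussSum (A * B) (fun x => f x * g x) =
      f B * g A * charGaussSum A f * charGaussSum B g := by
  have hA : (A : ℂ) ≠ 0 := Nat.cast_ne_zero.mpr (NeZero.ne A)
  have hB : (B : ℂ) ≠ 0 := Nat.cast_ne_zero.mpr (NeZero.ne B)
  have hfg := hf.mul_char hg hAB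
  have hper : Function.Periodic (fun x : ℤ => ((f x * g x : ℤ) : ℂ) * e (x / (A * B : ℕ)))
      (A * B : ℕ) := fun x => by
    have h1 : ((x + (A * B : ℕ) : ℤ) : ℂ) / (A * B : ℕ) = x / (A * B : ℕ) + (1 : ℤ) := by
      push_cast; field_simp
    change ((f _ * g _ : ℤ) : ℂ) * e (((x + (A * B : ℕ) : ℤ) : ℂ) / (A * B : ℕ)) = _
    have h2 : f (x + (A * B : ℕ)) * g (x + (A * B : ℕ)) = f x * g x :=
      hfg.congr (x + (A * B : ℕ)) x (by simp)
    rw [h2, h1, e_add, e_intCast, mul_one]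
  have h := hper.sum_mul_eq hAB
  simp only [Int.cast_natCast] at h
  rw [charGaussSum, h, charGaussSum, charGaussSum, mul_assoc, Finset.sum_mul_sum, Finset.mul_sum]
  refine Finset.sum_congr rfl fun x _ => ?_
  rw [Finset.mul_sum]
  refine Finset.sum_congr rfl fun y _ => ?_
  have h1 : f (x * B + y * A) = f x * f B := by
    rw [← hf.mul]; exact hf.congr _ _ (by simp)
  have h2 : g (x * B + y * A) = g y * g A := by
    rw [← hg.mul]; exact hg.congr _ _ (by simp)
  have h3 : ((x * B + y * A : ℤ) : ℂ) / (A * B : ℕ) = x / A + y / B := by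
    push_cast; field_simp
  rw [h1, h2, h3, e_add]
  push_cast
  ring

lemma e_sub_e_neg (x : ℝ) : e x - e (-x) = 2 * I * (Real.sin (2 * Real.pi * x) : ℂ) := by
  rw [e, e, Complex.ofReal_sin, Complex.sin]
  push_cast
  have h1 : 2 * (Real.pi : ℂ) * I * (-x) = -(2 * Real.pi * x) * I := by ring
  have h2 : 2 * (Real.pi : ℂ) * I * x = (2 * Real.pi * x) * I := by ring
  rw [h1, h2]
  linear_combination (cexp (-(2 * ↑Real.pi * ↑x) * I) - cexp (2 * ↑Real.pi * ↑x * I)) * -I_mul_I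

lemma sin_pos_of_odd_lt {M i : ℕ} (h : 2 * i < M) :
    0 < Real.sin (2 * Real.pi * ((2 * i + 1) / (2 * M + 1 : ℕ))) := by
  have hM : (0 : ℝ) < (2 * M + 1 : ℕ) := by positivity
  have hi : ((2 * i + 1 : ℕ) : ℝ) ≤ M := by exact_mod_cast h
  push_cast at hi hM ⊢
  have hpi := Real.pi_pos
  apply Real.sin_pos_of_pos_of_lt_pi
  · positivity
  · rw [mul_div_assoc', div_lt_iff₀ hM]
    nlinarith

lemma sin_neg_of_le_two_mul {M i : ℕ} (h : M ≤ 2 * i) (h' : i < M) :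
    Real.sin (2 * Real.pi * ((2 * i + 1) / (2 * M + 1 : ℕ))) < 0 := by
  have hM : (0 : ℝ) < (2 * M + 1 : ℕ) := by positivity
  have hi : ((i + 1 : ℕ) : ℝ) ≤ M := by exact_mod_cast h'
  have hi' : (M : ℝ) ≤ (2 * i : ℕ) := by exact_mod_cast h
  push_cast at hi hi' hM ⊢
  have hpi := Real.pi_pos
  rw [← Real.sin_sub_two_pi]
  apply Real.sin_neg_of_neg_of_neg_pi_lt
  · rw [sub_neg, mul_div_assoc', div_lt_iff₀ hM]
    nlinarith
  · have : Real.pi < 2 * Real.pi * ((2 * i + 1) / (2 * M + 1)) := by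
      rw [mul_div_assoc', lt_div_iff₀ hM]
      nlinarith
    linarith

lemma prod_sin_pos (M : ℕ) : 0 < (-1) ^ (M / 2) * ∏ i ∈ Finset.range M,
    Real.sin (2 * Real.pi * ((2 * i + 1) / (2 * M + 1 : ℕ))) := by
  obtain ⟨k, hk⟩ : ∃ k, M = k + M / 2 := ⟨M - M / 2, by omega⟩
  have h : ∏ i ∈ Finset.range M, Real.sin (2 * Real.pi * ((2 * i + 1) / (2 * M + 1 : ℕ))) =
      (∏ i ∈ Finset.range k, Real.sin (2 * Real.pi * ((2 * i + 1) / (2 * M + 1 : ℕ)))) *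
      ∏ i ∈ Finset.range (M / 2),
        Real.sin (2 * Real.pi * ((2 * (k + i : ℕ) + 1) / (2 * M + 1 : ℕ))) := by
    rw [← Finset.prod_range_add, ← hk]
  rw [h, mul_left_comm]
  apply mul_pos
  · refine Finset.prod_pos fun i hi => sin_pos_of_odd_lt ?_
    rw [Finset.mem_range] at hi
    omega
  · nth_rewrite 1 [← Finset.card_range (M / 2)]
    rw [← Finset.prod_const, ← Finset.prod_mul_distrib]
    refine Finset.prod_pos fun i hi => ?_
    rw [Finset.mem_range] at hi
    have := sin_neg_of_le_two_mul (M := M) (i := k + i) (by omega) (by omega)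
    linarith

/-- The expected value of a quadratic Gauss sum of odd order `n`. -/
def gaussUnit (n : ℕ) : ℂ := if n % 4 = 1 then 1 else I

lemma sum_sq_of_sq_eq {M : ℕ}
    (h : (∑ x ∈ Finset.range (2 * M + 1), e ((x : ℂ) ^ 2 / (2 * M + 1 : ℕ))) ^ 2 =
      (-1) ^ M * (2 * M + 1 : ℕ)) :
    ∑ x ∈ Finset.range (2 * M + 1), e ((x : ℂ) ^ 2 / (2 * M + 1 : ℕ)) =
      gaussUnit (2 * M + 1) * (Real.sqrt (2 * M + 1 : ℕ) : ℂ) := by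
  have h1 : ∑ x ∈ Finset.range (2 * M + 1), e ((x : ℂ) ^ 2 / (2 * M + 1 : ℕ)) =
      I ^ M * (((2 : ℝ) ^ M * ∏ i ∈ Finset.range M,
        Real.sin (2 * Real.pi * ((2 * i + 1) / (2 * M + 1 : ℕ))) : ℝ) : ℂ) := by
    rw [sum_sq_eq_prod]
    push_cast
    rw [← mul_assoc, ← mul_pow, mul_comm I 2]
    have hc : (2 * I) ^ M = ∏ _i ∈ Finset.range M, 2 * I := by simp
    rw [hc, ← Finset.prod_mul_distrib]
    refine Finset.prod_congr rfl fun i _ => ?_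
    have := e_sub_e_neg ((2 * i + 1) / (2 * M + 1 : ℕ))
    push_cast at this
    rw [← this, neg_div]
  set s : ℝ := ∏ i ∈ Finset.range M,
        Real.sin (2 * Real.pi * ((2 * i + 1) / (2 * M + 1 : ℕ))) with hs
  have hpos : 0 < (-1) ^ (M / 2) * s := prod_sin_pos M
  rw [h1, mul_pow, ← pow_mul, mul_comm M 2, pow_mul, I_sq] at h
  have h2 : ((-1) ^ (M / 2) * (2 ^ M * s)) ^ 2 = ((2 * M + 1 : ℕ) : ℝ) := by
    have h3 := mul_left_cancel₀ (pow_ne_zero M (by norm_num : (-1 : ℂ) ≠ 0)) h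
    have h4 : (2 ^ M * s) ^ 2 = ((2 * M + 1 : ℕ) : ℝ) := by exact_mod_cast h3
    rw [mul_pow, h4, ← pow_mul, mul_comm (M / 2), pow_mul, neg_one_sq, one_pow, one_mul]
  have h5 : (-1) ^ (M / 2) * (2 ^ M * s) = Real.sqrt (2 * M + 1 : ℕ) := by
    rw [← h2, Real.sqrt_sq]
    rw [mul_left_comm]
    positivity
  rw [h1, ← h5, gaussUnit]
  push_cast
  have h6 : (-1 : ℂ) ^ (M / 2) * (-1) ^ (M / 2) = 1 := by rw [← mul_pow]; simp
  rcases Nat.even_or_odd' M with ⟨m, rfl | rfl⟩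
  · rw [if_pos (by omega), pow_mul I, I_sq, show 2 * m / 2 = m by omega]
    ring
  · rw [if_neg (by omega), pow_succ I, pow_mul, I_sq, show (2 * m + 1) / 2 = m by omega]
    ring

section Prime
variable {p : ℕ} [Fact p.Prime]

lemma sum_legendre_eq_gaussSum :
    charGaussSum p (fun x => J(x | p)) =
      gaussSum ((quadraticChar (ZMod p)).ringHomComp (Int.castRingHom ℂ)) ZMod.stdAddChar := by
  rw [gaussSum, charGaussSum, ← sum_range_eq_sum_zmod p]
  refine Finset.sum_congr rfl fun x _ => ?_
  rw [← jacobiSym.legendreSym.to_jacobiSym]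
  have := stdAddChar_intCast p x
  push_cast at this
  rw [this]
  simp [legendreSym]

lemma sum_sq_eq_gaussSum (hp : p ≠ 2) :
    ∑ x ∈ Finset.range p, e ((x : ℂ) ^ 2 / p) =
      gaussSum ((quadraticChar (ZMod p)).ringHomComp (Int.castRingHom ℂ)) ZMod.stdAddChar := by
  have h0 : ∑ y : ZMod p, ZMod.stdAddChar y = (0 : ℂ) :=
    AddChar.sum_eq_zero_of_ne_one (by
      have := ZMod.isPrimitive_stdAddChar p
      have h := this (a := 1) one_ne_zero
      simpa using h)
  have h1 : ∑ x ∈ Finset.range p, e ((x : ℂ) ^ 2 / p) =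
      ∑ x : ZMod p, ZMod.stdAddChar (x ^ 2) := by
    rw [← sum_range_eq_sum_zmod p]
    refine Finset.sum_congr rfl fun x _ => ?_
    have := stdAddChar_intCast p (x ^ 2)
    push_cast at this
    rw [this]
  rw [h1, ← Finset.sum_fiberwise Finset.univ (fun x : ZMod p => x ^ 2)]
  have h2 : ∀ y : ZMod p, ∑ x with x ^ 2 = y, ZMod.stdAddChar (x ^ 2) =
      ((quadraticChar (ZMod p) y : ℂ) + 1) * ZMod.stdAddChar y := by
    intro y
    rw [Finset.sum_congr rfl (g := fun _ => ZMod.stdAddChar y)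
      (by intro x hx; rw [(Finset.mem_filter.mp hx).2]), Finset.sum_const, nsmul_eq_mul]
    congr 1
    have := quadraticChar_card_sqrts (F := ZMod p) (by rwa [ZMod.ringChar_zmod_n]) y
    have h3 : {x : ZMod p | x ^ 2 = y}.toFinset = Finset.univ.filter fun x => x ^ 2 = y := by
      ext; simp
    rw [h3] at this
    exact_mod_cast this
  simp only [h2, add_mul, one_mul, Finset.sum_add_distrib, h0, add_zero]
  rfl

lemma charGaussSum_prime (hp : p ≠ 2) :
    charGaussSum p (fun x => J(x | p)) = gaussUnit p * (Real.sqrt p : ℂ) := by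
  obtain ⟨M, hM⟩ := (Fact.out : p.Prime).odd_of_ne_two hp
  have h2 : ringChar (ZMod p) ≠ 2 := by rwa [ZMod.ringChar_zmod_n]
  rw [sum_legendre_eq_gaussSum, ← sum_sq_eq_gaussSum hp]
  have h := sum_sq_of_sq_eq (M := M) ?_
  · rw [← hM] at h
    exact h
  · rw [← hM, sum_sq_eq_gaussSum hp, gaussSum_sq]
    · rw [ZMod.card]
      congr 1
      have h := quadraticChar_neg_one h2
      rw [ZMod.card, ZMod.χ₄_eq_neg_one_pow (Nat.odd_iff.mp ⟨M, hM⟩),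
        show p / 2 = M by omega] at h
      simp [h]
    · exact (MulChar.ringHomComp_ne_one_iff (RingHom.injective_int _)).mpr (quadraticChar_ne_one h2)
    · exact (quadraticChar_isQuadratic _).comp _
    · exact ZMod.isPrimitive_stdAddChar p

end Prime

lemma isRealPrimitiveChar_prime {p : ℕ} [Fact p.Prime] (hp : p ≠ 2) :
    IsRealPrimitiveChar p (fun x => J(x | p)) where
  congr x y h := by
    rw [jacobiSym.mod_left x, jacobiSym.mod_left y, h]
  mul x y := jacobiSym.mul_left x y p
  zero x h := jacobiSym.eq_zero_iff_not_coprime.mpr h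
  sq x h := jacobiSym.eq_one_or_neg_one h
  prim q hq hqp := by
    obtain rfl := (Nat.prime_dvd_prime_iff_eq hq Fact.out).mp hqp
    obtain ⟨a, ha⟩ := quadraticChar_exists_neg_one' (F := ZMod q) (by rwa [ZMod.ringChar_zmod_n])
    refine ⟨(a : ZMod q).val, ?_, ?_⟩
    · rw [Nat.div_self hq.pos]
      simp [Int.modEq_one]
    · rw [← jacobiSym.legendreSym.to_jacobiSym, legendreSym]
      simpa using ha

lemma isRealPrimitiveChar_jacobiSym {n : ℕ} (hn : Odd n) (hsq : Squarefree n) :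
    IsRealPrimitiveChar n (fun x => J(x | n)) := by
  induction n using induction_on_primes with
  | zero => simp at hn
  | one => simpa using isRealPrimitiveChar_one
  | prime_mul p a hp ih =>
    have : Fact p.Prime := ⟨hp⟩
    have : NeZero p := ⟨hp.ne_zero⟩
    obtain ⟨hpo, hao⟩ := Nat.odd_mul.mp hn
    have : NeZero a := ⟨hao.pos.ne'⟩
    have hp2 : p ≠ 2 := by rintro rfl; exact absurd hpo (by decide)
    have h := (isRealPrimitiveChar_prime hp2).mul_char (ih hao hsq.of_mul_right)
      (Nat.coprime_of_squarefree_mul hsq)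
    simpa only [jacobiSym.mul_right] using h

lemma charGaussSum_jacobiSym {n : ℕ} (hn : Odd n) (hsq : Squarefree n) :
    charGaussSum n (fun x => J(x | n)) = gaussUnit n * (Real.sqrt n : ℂ) := by
  induction n using induction_on_primes with
  | zero => simp at hn
  | one => simp [charGaussSum, gaussUnit, e_zero]
  | prime_mul p a hp ih =>
    have : Fact p.Prime := ⟨hp⟩
    have : NeZero p := ⟨hp.ne_zero⟩
    obtain ⟨hpo, hao⟩ := Nat.odd_mul.mp hn
    have : NeZero a := ⟨hao.pos.ne'⟩
    have hp2 : p ≠ 2 := by rintro rfl; exact absurd hpo (by decide)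
    have hcop := Nat.coprime_of_squarefree_mul hsq
    have h := charGaussSum_mul (isRealPrimitiveChar_prime hp2)
      (isRealPrimitiveChar_jacobiSym hao hsq.of_mul_right) hcop
    have hs : (Real.sqrt ((p * a : ℕ) : ℝ) : ℂ) = Real.sqrt p * Real.sqrt a := by
      rw [Nat.cast_mul, Real.sqrt_mul (Nat.cast_nonneg _), Complex.ofReal_mul]
    have hu : (J(a | p) : ℂ) * J(p | a) * gaussUnit p * gaussUnit a = gaussUnit (p * a) := by
      have hq : J(a | p) * J(p | a) = if p % 4 = 3 ∧ a % 4 = 3 then -1 else 1 := by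
        have h1 : J(a | p) * J(a | p) = 1 := by
          rcases jacobiSym.eq_one_or_neg_one (a := a) (b := p)
            (by simpa using hcop.symm) with h | h <;> simp [h]
        split_ifs with h3
        · rw [jacobiSym.quadratic_reciprocity_three_mod_four h3.2 h3.1] at *
          have h2 : J(p | a) * J(p | a) = 1 := by linarith
          linarith
        · rcases Nat.odd_mod_four_iff.mp (Nat.odd_iff.mp hpo) with h4 | h4
          · rw [jacobiSym.quadratic_reciprocity_one_mod_four h4 hao]
            exact h1
          · have h5 : a % 4 = 1 := by
              rcases Nat.odd_mod_four_iff.mp (Nat.odd_iff.mp hao) with h5 | h5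
              · exact h5
              · exact absurd ⟨h4, h5⟩ h3
            rw [jacobiSym.quadratic_reciprocity_one_mod_four h5 hpo] at *
            exact h1
      have hq' : (J(a | p) : ℂ) * J(p | a) = if p % 4 = 3 ∧ a % 4 = 3 then -1 else 1 := by
        have := congrArg (Int.cast : ℤ → ℂ) hq
        push_cast at this
        exact this
      rw [hq', gaussUnit, gaussUnit, gaussUnit, Nat.mul_mod]
      rcases Nat.odd_mod_four_iff.mp (Nat.odd_iff.mp hpo) with h4 | h4 <;>
      rcases Nat.odd_mod_four_iff.mp (Nat.odd_iff.mp hao) with h5 | h5 <;> simp [h4, h5]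
    simp only [jacobiSym.mul_right]
    rw [h, charGaussSum_prime hp2, ih hao hsq.of_mul_right, hs, ← hu]
    ring

lemma isRealPrimitiveChar_zmod {m : ℕ} [NeZero m] (χ : MulChar (ZMod m) ℤ) (hχ : χ.IsQuadratic)
    (hprim : ∀ p : ℕ, p.Prime → p ∣ m → ∃ u : ℤ, u ≡ 1 [ZMOD (m / p : ℕ)] ∧ χ u = -1) :
    IsRealPrimitiveChar m (fun x => χ (x : ZMod m)) where
  congr x y h := by
    rw [(ZMod.intCast_eq_intCast_iff _ _ _).mpr h]
  mul x y := by push_cast; exact map_mul χ _ _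
  zero x h := MulChar.map_nonunit χ (by
    rwa [ZMod.coe_int_isUnit_iff_isCoprime, isCoprime_comm, Int.isCoprime_iff_gcd_eq_one])
  sq x h := by
    have hu : IsUnit (x : ZMod m) := by
      rwa [ZMod.coe_int_isUnit_iff_isCoprime, isCoprime_comm, Int.isCoprime_iff_gcd_eq_one]
    rcases hχ x with h1 | h1
    · exact absurd h1 (hu.map χ).ne_zero
    · exact h1
  prim := hprim

lemma isRealPrimitiveChar_χ₄ : IsRealPrimitiveChar 4 (fun x => ZMod.χ₄ (x : ZMod 4)) :=
  isRealPrimitiveChar_zmod _ ZMod.isQuadratic_χ₄ fun p hp h => by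
    obtain rfl := (Nat.prime_dvd_prime_iff_eq hp Nat.prime_two).mp (hp.dvd_of_dvd_pow (n := 2) h)
    exact ⟨3, by decide, by decide⟩

lemma isRealPrimitiveChar_χ₈ : IsRealPrimitiveChar 8 (fun x => ZMod.χ₈ (x : ZMod 8)) :=
  isRealPrimitiveChar_zmod _ ZMod.isQuadratic_χ₈ fun p hp h => by
    obtain rfl := (Nat.prime_dvd_prime_iff_eq hp Nat.prime_two).mp (hp.dvd_of_dvd_pow (n := 3) h)
    exact ⟨5, by decide, by decide⟩

lemma isRealPrimitiveChar_χ₈' : IsRealPrimitiveChar 8 (fun x => ZMod.χ₈' (x : ZMod 8)) :=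
  isRealPrimitiveChar_zmod _ ZMod.isQuadratic_χ₈' fun p hp h => by
    obtain rfl := (Nat.prime_dvd_prime_iff_eq hp Nat.prime_two).mp (hp.dvd_of_dvd_pow (n := 3) h)
    exact ⟨5, by decide, by decide⟩

lemma e_one_div_four : e (1 / 4) = I := by
  rw [e]
  exact (congrArg cexp (by ring)).trans Complex.exp_pi_div_two_mul_I

lemma e_one_div_eight : e (1 / 8) = (1 + I) / Real.sqrt 2 := by
  have h : Real.sqrt 2 * Real.sqrt 2 = 2 := Real.mul_self_sqrt (by norm_num)
  have h' : (Real.sqrt 2 : ℂ) * Real.sqrt 2 = 2 := by exact_mod_cast h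
  have h0 : (Real.sqrt 2 : ℂ) ≠ 0 := by intro h; simp [h] at h'
  rw [e, show 2 * (Real.pi : ℂ) * I * (1 / 8) = ((Real.pi / 4 : ℝ) : ℂ) * I by push_cast; ring,
    Complex.exp_mul_I, ← Complex.ofReal_cos, ← Complex.ofReal_sin, Real.cos_pi_div_four,
    Real.sin_pi_div_four]
  push_cast
  field_simp
  linear_combination (1 + I) * h'

lemma e_div_eq_pow (x m : ℕ) : e (x / m) = e (1 / m) ^ x := by
  rw [← e_natCast_mul, mul_one_div]

lemma charGaussSum_χ₄ : charGaussSum 4 (fun x => ZMod.χ₄ (x : ZMod 4)) = 2 * I := by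
  have h : e (1 / (4 : ℕ)) = I := by simpa using e_one_div_four
  have h0 : ZMod.χ₄ 0 = 0 := by decide
  have h1 : ZMod.χ₄ 1 = 1 := by decide
  have h2 : ZMod.χ₄ 2 = 0 := by decide
  have h3 : ZMod.χ₄ 3 = -1 := by decide
  simp only [charGaussSum, e_div_eq_pow, h, Finset.sum_range_succ, Finset.sum_range_zero]
  push_cast
  simp only [h0, h1, h2, h3]
  push_cast
  linear_combination (-I) * I_sq

lemma e_one_div_eight_sq : e (1 / (8 : ℕ)) ^ 2 = I := by
  rw [← e_natCast_mul, ← e_one_div_four]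
  congr 1
  norm_num

lemma sqrt_eight_eq : (Real.sqrt (8 : ℕ) : ℂ) = 2 * Real.sqrt 2 := by
  rw [show ((8 : ℕ) : ℝ) = 2 ^ 2 * 2 by norm_num, Real.sqrt_mul (by norm_num),
    Real.sqrt_sq (by norm_num)]
  push_cast
  rfl

lemma charGaussSum_χ₈ : charGaussSum 8 (fun x => ZMod.χ₈ (x : ZMod 8)) = Real.sqrt (8 : ℕ) := by
  have h : e (1 / (8 : ℕ)) * Real.sqrt 2 = 1 + I := by
    rw [Nat.cast_ofNat, e_one_div_eight, div_mul_cancel₀ _ (by simp)]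
  have h0 : ZMod.χ₈ 0 = 0 := by decide
  have h1 : ZMod.χ₈ 1 = 1 := by decide
  have h2 : ZMod.χ₈ 2 = 0 := by decide
  have h3 : ZMod.χ₈ 3 = -1 := by decide
  have h4 : ZMod.χ₈ 4 = 0 := by decide
  have h5 : ZMod.χ₈ 5 = -1 := by decide
  have h6 : ZMod.χ₈ 6 = 0 := by decide
  have h7 : ZMod.χ₈ 7 = 1 := by decide
  have hs := e_one_div_eight_sq
  simp only [charGaussSum, e_div_eq_pow _ 8, Finset.sum_range_succ, Finset.sum_range_zero]
  rw [sqrt_eight_eq]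
  generalize e (1 / (8 : ℕ)) = w at *
  have w3 : w ^ 3 = I * w := by linear_combination w * hs
  have w5 : w ^ 5 = -w := by linear_combination (w ^ 3 + I * w) * hs + w * I_sq
  have w7 : w ^ 7 = -I * w := by linear_combination w ^ 5 * hs + I * w5
  push_cast
  simp only [h0, h1, h2, h3, h4, h5, h6, h7]
  have h' : (Real.sqrt 2 : ℂ) * Real.sqrt 2 = 2 := by
    exact_mod_cast Real.mul_self_sqrt (by norm_num : (0 : ℝ) ≤ 2)
  refine mul_right_cancel₀ (b := (Real.sqrt 2 : ℂ)) (by simp) ?_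
  push_cast
  linear_combination (Real.sqrt 2 : ℂ) * (w7 - w3 - w5) + 2 * (1 - I) * h - 2 * h' - 2 * I_sq

lemma charGaussSum_χ₈' :
    charGaussSum 8 (fun x => ZMod.χ₈' (x : ZMod 8)) = I * Real.sqrt (8 : ℕ) := by
  have h : e (1 / (8 : ℕ)) * Real.sqrt 2 = 1 + I := by
    rw [Nat.cast_ofNat, e_one_div_eight, div_mul_cancel₀ _ (by simp)]
  have h0 : ZMod.χ₈' 0 = 0 := by decide
  have h1 : ZMod.χ₈' 1 = 1 := by decide
  have h2 : ZMod.χ₈' 2 = 0 := by decide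
  have h3 : ZMod.χ₈' 3 = 1 := by decide
  have h4 : ZMod.χ₈' 4 = 0 := by decide
  have h5 : ZMod.χ₈' 5 = -1 := by decide
  have h6 : ZMod.χ₈' 6 = 0 := by decide
  have h7 : ZMod.χ₈' 7 = -1 := by decide
  have hs := e_one_div_eight_sq
  simp only [charGaussSum, e_div_eq_pow _ 8, Finset.sum_range_succ, Finset.sum_range_zero]
  rw [sqrt_eight_eq]
  generalize e (1 / (8 : ℕ)) = w at *
  have w3 : w ^ 3 = I * w := by linear_combination w * hs
  have w5 : w ^ 5 = -w := by linear_combination (w ^ 3 + I * w) * hs + w * I_sq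
  have w7 : w ^ 7 = -I * w := by linear_combination w ^ 5 * hs + I * w5
  push_cast
  simp only [h0, h1, h2, h3, h4, h5, h6, h7]
  have h' : (Real.sqrt 2 : ℂ) * Real.sqrt 2 = 2 := by
    exact_mod_cast Real.mul_self_sqrt (by norm_num : (0 : ℝ) ≤ 2)
  refine mul_right_cancel₀ (b := (Real.sqrt 2 : ℂ)) (by simp) ?_
  push_cast
  linear_combination (Real.sqrt 2 : ℂ) * (w3 - w5 - w7) + 2 * (1 + I) * h - 2 * I * h' + 2 * I_sq

lemma jacobiSym_natAbs_of_mod_four {d : ℤ} (hd : d % 4 = 1) {m : ℕ} (hm : Odd m) :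
    J(d | m) = J(m | d.natAbs) := by
  have hm2 := Nat.odd_mod_four_iff.mp (Nat.odd_iff.mp hm)
  rcases Int.natAbs_eq d with h | h
  · have hD : d.natAbs % 4 = 1 := by omega
    nth_rewrite 1 [h]
    exact jacobiSym.quadratic_reciprocity_one_mod_four hD hm
  · have hD : d.natAbs % 4 = 3 := by omega
    nth_rewrite 1 [h]
    rw [jacobiSym.neg _ hm]
    rcases hm2 with h1 | h3
    · rw [ZMod.χ₄_nat_one_mod_four h1, one_mul,
        jacobiSym.quadratic_reciprocity_one_mod_four h1 (Nat.odd_iff.mpr (by omega))]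
    · rw [ZMod.χ₄_nat_three_mod_four h3, jacobiSym.quadratic_reciprocity_three_mod_four hD h3]
      ring

lemma gaussUnit_natAbs {d : ℤ} (hd : d % 4 = 1) :
    gaussUnit d.natAbs = if 0 < d then 1 else I := by
  rw [gaussUnit]
  congr 1
  exact propext ⟨fun h => by omega, fun h => by omega⟩

lemma χ₄_natAbs {d : ℤ} (hd : d % 4 = 1) :
    ZMod.χ₄ (d.natAbs : ZMod 4) = if 0 < d then 1 else -1 := by
  split_ifs with h
  · exact ZMod.χ₄_nat_one_mod_four (by omega)
  · exact ZMod.χ₄_nat_three_mod_four (by omega)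

lemma kronecker_eq_of_multiplicative {Δ : ℤ} {ψ : ℤ → ℤ} (h1 : ψ 1 = 1)
    (hmul : ∀ x y, ψ (x * y) = ψ x * ψ y) (hodd : ∀ m : ℕ, Odd m → ψ m = J(Δ | m))
    (htwo : Odd Δ → ψ 2 = kron2 Δ) {n : ℤ} (hn : 0 < n) (hco : Int.gcd n Δ = 1) :
    ψ n = kronecker Δ n := by
  lift n to ℕ using hn.le
  have hn0 : n ≠ 0 := by omega
  rw [kronecker, if_neg hn.ne', if_neg (by omega), one_mul, Int.natAbs_natCast,
    ← hodd _ (Nat.odd_iff.mpr (Nat.two_dvd_ne_zero.mp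
      (Nat.not_dvd_ordCompl Nat.prime_two hn0)))]
  have hn' : (n : ℤ) = 2 ^ n.factorization 2 * (n / 2 ^ n.factorization 2 : ℕ) := by
    exact_mod_cast (Nat.ordProj_mul_ordCompl_eq_self n 2).symm
  have hpow : ∀ k, ψ (2 ^ k) = ψ 2 ^ k := by
    intro k
    induction k with
    | zero => simpa
    | succ k ih => rw [pow_succ, hmul, ih, pow_succ]
  nth_rewrite 1 [hn']
  rw [hmul, hpow]
  congr 1
  rcases Int.even_or_odd Δ with h | h
  · have : n.factorization 2 = 0 := by
      refine Nat.factorization_eq_zero_of_not_dvd fun h2 => ?_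
      have h3 := Int.dvd_coe_gcd (Int.natCast_dvd_natCast.mpr h2) h.two_dvd
      rw [hco] at h3
      norm_num at h3
    simp [this]
  · rw [htwo h]

lemma jacobiSym_four {m : ℕ} (hm : Odd m) : J(4 | m) = 1 := by
  have : Int.gcd 2 m = 1 := by
    simpa [Int.gcd] using hm.coprime_two_left
  exact jacobiSym.sq_one' (a := 2) this

lemma jacobiSym_eight {m : ℕ} (hm : Odd m) : J(8 | m) = ZMod.χ₈ m := by
  rw [show (8 : ℤ) = 4 * 2 by norm_num, jacobiSym.mul_left, jacobiSym_four hm, one_mul,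
    jacobiSym.at_two hm]

/-- `ψ` is the real primitive character attached to the fundamental discriminant `Δ`. -/
structure IsDiscriminantChar (Δ : ℤ) (ψ : ℤ → ℤ) : Prop where
  char : IsRealPrimitiveChar Δ.natAbs ψ
  gauss : charGaussSum Δ.natAbs ψ = (if 0 < Δ then 1 else I) * (Real.sqrt Δ.natAbs : ℂ)
  eq_kronecker : ∀ n : ℤ, 0 < n → Int.gcd n Δ = 1 → ψ n = kronecker Δ n

section
variable {d : ℤ}

lemma isDiscriminantChar_of_odd (hd : d % 4 = 1) (hsq : Squarefree d) :
    IsDiscriminantChar d (fun x => J(x | d.natAbs)) := by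
  have hodd : Odd d.natAbs := Nat.odd_iff.mpr (by omega)
  have hsq' : Squarefree d.natAbs := Int.squarefree_natAbs.mpr hsq
  have hchar := isRealPrimitiveChar_jacobiSym hodd hsq'
  refine ⟨hchar, ?_, fun n hn hco =>
    kronecker_eq_of_multiplicative (ψ := fun x => J(x | d.natAbs)) hchar.one hchar.mul
    (fun m hm => (jacobiSym_natAbs_of_mod_four hd hm).symm) (fun _ => ?_) hn hco⟩
  · rw [charGaussSum_jacobiSym hodd hsq', gaussUnit_natAbs hd]
  · rw [jacobiSym.at_two hodd, ZMod.χ₈_nat_eq_if_mod_eight, kron2]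
    have h1 : ¬ d.natAbs % 2 = 0 := by omega
    have h2 : ¬ d % 2 = 0 := by omega
    rw [if_neg h1, if_neg h2]
    congr 1
    exact propext ⟨fun h => by omega, fun h => by omega⟩

lemma isDiscriminantChar_of_even {E : ℕ} [NeZero E] {f : ℤ → ℤ} {ε : ℤ} {Δ : ℤ} {τ : ℂ}
    (hd : d % 4 = 1) (hsq : Squarefree d) (hE : Even E) (hEd : E.Coprime d.natAbs)
    (hε : ε = 1 ∨ ε = -1) (hΔ : Δ = ε * E * d)
    (hf : IsRealPrimitiveChar E f) (hτ : charGaussSum E f = τ * (Real.sqrt E : ℂ))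
    (hfJ : ∀ m : ℕ, Odd m → f m = J(ε * E | m))
    (hsign : ((f d.natAbs * J(E | d.natAbs) : ℤ) : ℂ) * τ * (if 0 < d then 1 else I) =
      if 0 < ε * d then 1 else I) :
    IsDiscriminantChar Δ (fun x => f x * J(x | d.natAbs)) := by
  have hodd : Odd d.natAbs := Nat.odd_iff.mpr (by omega)
  have hsq' : Squarefree d.natAbs := Int.squarefree_natAbs.mpr hsq
  have hD : Δ.natAbs = E * d.natAbs := by
    rw [hΔ, Int.natAbs_mul, Int.natAbs_mul]
    rcases hε with rfl | rfl <;> simp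
  have hpos : 0 < Δ ↔ 0 < ε * d := by
    have hE0 : (0 : ℤ) < E := by exact_mod_cast (NeZero.pos E)
    rw [hΔ, mul_right_comm, mul_pos_iff_of_pos_right hE0]
  have : NeZero d.natAbs := ⟨hodd.pos.ne'⟩
  have hJ := isRealPrimitiveChar_jacobiSym hodd hsq'
  have hchar := hf.mul_char hJ hEd
  refine ⟨hD ▸ hchar, ?_, fun n hn hco =>
    kronecker_eq_of_multiplicative (ψ := fun x => f x * J(x | d.natAbs)) hchar.one hchar.mul
    (fun m hm => ?_) (fun h => ?_) hn hco⟩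
  · rw [hD, charGaussSum_mul hf hJ hEd, charGaussSum_jacobiSym hodd hsq', gaussUnit_natAbs hd, hτ,
      Nat.cast_mul, Real.sqrt_mul (Nat.cast_nonneg _)]
    simp only [hpos]
    rw [← hsign]
    push_cast
    ring
  · rw [hΔ, jacobiSym.mul_left, hfJ m hm, jacobiSym_natAbs_of_mod_four hd hm]
  · exfalso
    rw [hΔ] at h
    have h2 : Even (ε * (E : ℤ) * d) := (((Int.even_coe_nat E).mpr hE).mul_left ε).mul_right d
    exact (Int.not_even_iff_odd.mpr h) h2

end

lemma IsFundamentalDiscriminant.exists_char {Δ : ℤ} (hΔ : IsFundamentalDiscriminant Δ) :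
    ∃ ψ, IsDiscriminantChar Δ ψ := by
  have hsqrt4 : Real.sqrt (4 : ℕ) = 2 := by
    rw [show ((4 : ℕ) : ℝ) = 2 ^ 2 by norm_num, Real.sqrt_sq (by norm_num)]
  have hχχ : ∀ {m : ℕ}, Odd m → ZMod.χ₈ (m : ZMod 8) * ZMod.χ₈ (m : ZMod 8) = 1 := fun {m} hm => by
    rw [← jacobiSym_eight hm, ← sq, ← jacobiSym.pow_left]
    have : Int.gcd 8 m = 1 := by
      have := (hm.coprime_two_left).pow_left 3
      simpa [Int.gcd] using this
    exact jacobiSym.sq_one' this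
  have hneg : ∀ {m : ℤ}, Squarefree m → Squarefree (-m) := fun {m} h => by
    rwa [← Int.squarefree_natAbs, Int.natAbs_neg, Int.squarefree_natAbs]
  have hI : ∀ {d : ℤ}, d ≠ 0 → (((if 0 < d then 1 else -1) * 1 : ℤ) : ℂ) * I *
      (if 0 < d then 1 else I) = if 0 < -1 * d then 1 else I := fun {d} hd => by
    by_cases h : 0 < d
    · rw [if_pos h, if_pos h, if_neg (by omega)]; simp
    · rw [if_neg h, if_neg h, if_pos (by omega)]; simp
  rcases hΔ with ⟨h1, h2⟩ | ⟨h0, h2, h3 | h3⟩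
  · exact ⟨_, isDiscriminantChar_of_odd h1 h2⟩
  · obtain ⟨m, hm⟩ : ∃ m, Δ = 8 * m := ⟨Δ / 8, by omega⟩
    have h4 : Δ / 4 = 2 * m := by omega
    rw [h4] at h2 h3
    have hcop : Nat.Coprime 8 m.natAbs :=
      (Nat.coprime_two_left.mpr (Nat.odd_iff.mpr (by omega))).pow_left 3
    have hodd : Odd m.natAbs := Nat.odd_iff.mpr (by omega)
    have h6 := hχχ hodd
    have h7 : J((8 : ℕ) | m.natAbs) = ZMod.χ₈ m.natAbs := by
      simpa using jacobiSym_eight hodd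
    rcases (by omega : m % 4 = 1 ∨ m % 4 = 3) with h5 | h5
    · refine ⟨_, isDiscriminantChar_of_even (d := m) (E := 8) (ε := 1) (τ := 1) h5
        h2.of_mul_right (by decide) hcop (Or.inl rfl) (by rw [hm]; norm_num) isRealPrimitiveChar_χ₈
        (by rw [charGaussSum_χ₈, one_mul]) (fun m hm => ?_) ?_⟩
      · have := jacobiSym_eight hm
        simpa using this.symm
      · rw [h7, Int.cast_natCast, h6]
        simp
    · have hcop' : Nat.Coprime 8 (-m).natAbs := by rwa [Int.natAbs_neg]
      refine ⟨_, isDiscriminantChar_of_even (d := -m) (E := 8) (ε := -1) (τ := I) (by omega)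
        (hneg h2.of_mul_right) (by decide) hcop' (Or.inr rfl)
        (by rw [hm]; norm_num) isRealPrimitiveChar_χ₈' charGaussSum_χ₈' (fun m hm => ?_) ?_⟩
      · rw [ZMod.χ₈'_int_eq_χ₄_mul_χ₈, neg_one_mul, jacobiSym.neg _ hm]
        congr 1
        have := jacobiSym_eight hm
        simpa using this.symm
      · have h8 := χ₄_natAbs (d := -m) (by omega)
        rw [ZMod.χ₈'_int_eq_χ₄_mul_χ₈, Int.cast_natCast, h8, Int.natAbs_neg, h7,
          Int.cast_natCast, mul_assoc (ite _ _ _), h6]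
        exact hI (by omega)
  · set m := Δ / 4 with hm
    have hodd : Odd (-m).natAbs := Nat.odd_iff.mpr (by omega)
    have hcop : Nat.Coprime 4 (-m).natAbs := (Nat.coprime_two_left.mpr hodd).pow_left 2
    refine ⟨_, isDiscriminantChar_of_even (d := -m) (E := 4) (ε := -1) (τ := I) (by omega)
      (hneg h2) (by decide) hcop (Or.inr rfl) (by push_cast; omega) isRealPrimitiveChar_χ₄
      (by rw [charGaussSum_χ₄, hsqrt4]; push_cast; ring) (fun m hm => ?_) ?_⟩
    · have := jacobiSym_four hm
      rw [neg_one_mul, jacobiSym.neg _ hm]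
      simp [this]
    · have h8 := χ₄_natAbs (d := -m) (by omega)
      have h9 : J((4 : ℕ) | (-m).natAbs) = 1 := by simpa using jacobiSym_four hodd
      rw [h9, Int.cast_natCast, h8]
      exact hI (by omega)

section Isotropic
variable {R : Type}

/-- Exchange of the two hyperbolic coordinates. -/
def swapMove (v : R × R × R × R) : R × R × R × R := (v.2.2.2, v.2.1, v.2.2.1, v.1)

lemma swapMove_swapMove (v : R × R × R × R) : swapMove (swapMove v) = v := rfl

variable [CommRing R]

/-- The binary quadratic form `k h² + r h t + n t²`. -/
def binForm (k r n h t : R) : R := k * h ^ 2 + r * h * t + n * t ^ 2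

/-- The polar form of `binForm`. -/
def binPolar (k r n h t s₁ s₂ : R) : R := 2 * k * h * s₁ + r * (h * s₂ + t * s₁) + 2 * n * t * s₂

/-- The quadratic form `k h² + r h t + n t² - a c` on quadruples `(a, h, t, c)`. -/
def quatForm (k r n : R) (v : R × R × R × R) : R :=
  binForm k r n v.2.1 v.2.2.1 - v.1 * v.2.2.2

/-- The polar form of `quatForm`. -/
def quatPolar (k r n : R) (v w : R × R × R × R) : R :=
  binPolar k r n v.2.1 v.2.2.1 w.2.1 w.2.2.1 - v.1 * w.2.2.2 - w.1 * v.2.2.2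

/-- A Siegel transformation fixing `(1, 0, 0, 0)`. -/
def lowerMove (k r n s₁ s₂ : R) (v : R × R × R × R) : R × R × R × R :=
  (v.1 + binPolar k r n v.2.1 v.2.2.1 s₁ s₂ + v.2.2.2 * binForm k r n s₁ s₂,
    v.2.1 + v.2.2.2 * s₁, v.2.2.1 + v.2.2.2 * s₂, v.2.2.2)

lemma quatForm_swapMove (k r n : R) (v : R × R × R × R) :
    quatForm k r n (swapMove v) = quatForm k r n v := by
  simp only [quatForm, swapMove]; ring

lemma quatPolar_swapMove (k r n : R) (v w : R × R × R × R) :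
    quatPolar k r n (swapMove v) (swapMove w) = quatPolar k r n v w := by
  simp only [quatPolar, swapMove]; ring

lemma quatForm_lowerMove (k r n s₁ s₂ : R) (v : R × R × R × R) :
    quatForm k r n (lowerMove k r n s₁ s₂ v) = quatForm k r n v := by
  simp only [quatForm, lowerMove, binForm, binPolar]; ring

lemma quatPolar_lowerMove (k r n s₁ s₂ : R) (v w : R × R × R × R) :
    quatPolar k r n (lowerMove k r n s₁ s₂ v) (lowerMove k r n s₁ s₂ w) = quatPolar k r n v w := by
  simp only [quatPolar, lowerMove, binForm, binPolar]; ring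

lemma lowerMove_lowerMove (k r n s₁ s₂ s₁' s₂' : R) (v : R × R × R × R) :
    lowerMove k r n s₁' s₂' (lowerMove k r n s₁ s₂ v) =
      lowerMove k r n (s₁ + s₁') (s₂ + s₂') v := by
  simp only [lowerMove, binForm, binPolar, Prod.mk.injEq, and_true]
  refine ⟨?_, ?_, ?_⟩ <;> ring

lemma lowerMove_zero (k r n : R) (v : R × R × R × R) : lowerMove k r n 0 0 v = v := by
  simp [lowerMove, binForm, binPolar]

lemma lowerMove_smul (k r n s₁ s₂ u : R) (v : R × R × R × R) :
    lowerMove k r n s₁ s₂ (u • v) = u • lowerMove k r n s₁ s₂ v := by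
  ext <;> simp only [lowerMove, binForm, binPolar, Prod.smul_fst, Prod.smul_snd, smul_eq_mul] <;>
    ring

lemma lowerMove_bijective (k r n s₁ s₂ : R) : Function.Bijective (lowerMove k r n s₁ s₂) := by
  refine Function.bijective_iff_has_inverse.mpr ⟨lowerMove k r n (-s₁) (-s₂), fun v => ?_,
    fun v => ?_⟩
  · rw [lowerMove_lowerMove, add_neg_cancel, add_neg_cancel, lowerMove_zero]
  · rw [lowerMove_lowerMove, neg_add_cancel, neg_add_cancel, lowerMove_zero]

/-- `Ψ` is a primitive real character of the finite ring `R`. -/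
structure IsRealRingChar (Ψ : R → ℝ) : Prop where
  mul : ∀ x y, Ψ (x * y) = Ψ x * Ψ y
  sq : ∀ x, IsUnit x → Ψ x = 1 ∨ Ψ x = -1
  nonunit : ∀ x, ¬ IsUnit x → Ψ x = 0
  prim : ∀ x, ¬ IsUnit x → ∃ u, IsUnit u ∧ Ψ u = -1 ∧ u * x = x

/-- `Φ` is a function on isotropic vectors induced by the character `Ψ`. -/
structure IsIsotropicChar (k r n : R) (Ψ : R → ℝ) (Φ : R × R × R × R → ℝ) : Prop where
  supp : ∀ v, quatForm k r n v ≠ 0 → Φ v = 0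
  left : ∀ v s₁ s₂, quatForm k r n v = 0 → IsUnit (lowerMove k r n s₁ s₂ v).1 →
    Φ v = Ψ (lowerMove k r n s₁ s₂ v).1
  right : ∀ v s₁ s₂, quatForm k r n v = 0 → IsUnit (lowerMove k r n s₁ s₂ (swapMove v)).1 →
    Φ v = Ψ (lowerMove k r n s₁ s₂ (swapMove v)).1
  exists_left : ∀ v, Φ v ≠ 0 → ∃ s₁ s₂, IsUnit (lowerMove k r n s₁ s₂ v).1
  exists_right : ∀ v, Φ v ≠ 0 → ∃ s₁ s₂, IsUnit (lowerMove k r n s₁ s₂ (swapMove v)).1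
  degenerate : ∀ v, quatForm k r n v = 0 → Φ v = 0 →
    ∃ u, IsUnit u ∧ Ψ u = -1 ∧ ∀ w, (u - 1) * quatPolar k r n v w = 0

variable {k r n : R} {Ψ : R → ℝ} {Φ : R × R × R × R → ℝ}

lemma IsIsotropicChar.swap (hΦ : IsIsotropicChar k r n Ψ Φ) :
    IsIsotropicChar k r n Ψ (fun v => Φ (swapMove v)) where
  supp v h := hΦ.supp _ (by rwa [quatForm_swapMove])
  left v s₁ s₂ h hu := hΦ.right _ s₁ s₂ (by rwa [quatForm_swapMove]) hu
  right v s₁ s₂ h hu := hΦ.left _ s₁ s₂ (by rwa [quatForm_swapMove]) hu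
  exists_left v h := hΦ.exists_right _ h
  exists_right v h := hΦ.exists_left _ h
  degenerate v h h0 := by
    obtain ⟨u, hu, hΨ, hw⟩ := hΦ.degenerate (swapMove v) (by rwa [quatForm_swapMove]) h0
    refine ⟨u, hu, hΨ, fun w => ?_⟩
    rw [← quatPolar_swapMove]
    exact hw _

lemma IsIsotropicChar.form_eq_zero (hΦ : IsIsotropicChar k r n Ψ Φ) {v : R × R × R × R}
    (h : Φ v ≠ 0) : quatForm k r n v = 0 :=
  by_contra fun h' => h (hΦ.supp v h')

lemma IsIsotropicChar.lowerMove (hΦ : IsIsotropicChar k r n Ψ Φ) (s₁ s₂ : R) (v : R × R × R × R) :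
    Φ (lowerMove k r n s₁ s₂ v) = Φ v := by
  have key : ∀ s₁ s₂ v, Φ v ≠ 0 → Φ (_root_.lowerMove k r n s₁ s₂ v) = Φ v := by
    intro s₁ s₂ v hv
    have hq := hΦ.form_eq_zero hv
    obtain ⟨x₁, x₂, hx⟩ := hΦ.exists_left v hv
    have h := lowerMove_lowerMove k r n s₁ s₂ (x₁ - s₁) (x₂ - s₂) v
    rw [add_sub_cancel, add_sub_cancel] at h
    rw [hΦ.left v x₁ x₂ hq hx, ← h]
    exact hΦ.left _ _ _ (by rwa [quatForm_lowerMove]) (by rwa [h])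
  by_cases hv : Φ v = 0
  · by_contra h
    rw [hv] at h
    have h1 := key (-s₁) (-s₂) _ h
    rw [lowerMove_lowerMove, add_neg_cancel, add_neg_cancel, lowerMove_zero] at h1
    exact h (h1.symm.trans hv)
  · exact key s₁ s₂ v hv

lemma quatForm_smul (u : R) (v : R × R × R × R) :
    quatForm k r n (u • v) = u ^ 2 * quatForm k r n v := by
  simp only [quatForm, binForm, Prod.smul_fst, Prod.smul_snd, smul_eq_mul]; ring

lemma quatPolar_smul_right (u : R) (v w : R × R × R × R) :
    quatPolar k r n v (u • w) = u * quatPolar k r n v w := by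
  simp only [quatPolar, binPolar, Prod.smul_fst, Prod.smul_snd, smul_eq_mul]; ring

lemma quatPolar_smul_left (u : R) (v w : R × R × R × R) :
    quatPolar k r n (u • v) w = u * quatPolar k r n v w := by
  simp only [quatPolar, binPolar, Prod.smul_fst, Prod.smul_snd, smul_eq_mul]; ring

/-- `quatPolar` as an additive map in its first argument. -/
def quatPolarHom (k r n : R) (w : R × R × R × R) : R × R × R × R →+ R where
  toFun v := quatPolar k r n v w
  map_zero' := by simp [quatPolar, binPolar]
  map_add' v v' := by
    simp only [quatPolar, binPolar, Prod.fst_add, Prod.snd_add]; ring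

lemma quatPolar_sub_right (v w w' : R × R × R × R) :
    quatPolar k r n v (w' - w) = quatPolar k r n v w' - quatPolar k r n v w := by
  simp only [quatPolar, binPolar, Prod.fst_sub, Prod.snd_sub]; ring

lemma IsIsotropicChar.smul (hΨ : IsRealRingChar Ψ) (hΦ : IsIsotropicChar k r n Ψ Φ) {u : R}
    (hu : IsUnit u) (v : R × R × R × R) : Φ (u • v) = Ψ u * Φ v := by
  have key : ∀ u v, IsUnit u → Φ v ≠ 0 → Φ (u • v) = Ψ u * Φ v := by
    intro u v hu hv
    have hq := hΦ.form_eq_zero hv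
    obtain ⟨x₁, x₂, hx⟩ := hΦ.exists_left v hv
    rw [hΦ.left v x₁ x₂ hq hx, ← hΨ.mul, hΦ.left (u • v) x₁ x₂ (by rw [quatForm_smul, hq, mul_zero])]
    · rw [lowerMove_smul]; rfl
    · rw [lowerMove_smul]; exact hu.mul hx
  by_cases hv : Φ v = 0
  · by_contra h
    rw [hv, mul_zero] at h
    obtain ⟨u, rfl⟩ := hu
    have h1 := key _ _ (u⁻¹).isUnit h
    rw [smul_smul, Units.inv_mul, one_smul, hv] at h1
    rcases hΨ.sq _ (u⁻¹).isUnit with h2 | h2 <;> rw [h2] at h1 <;> apply h <;> linarith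
  · exact key u v hu hv

section Fourier
variable [Fintype R] (φ : AddChar R ℂ)

/-- The Fourier transform of `Φ` with respect to `quatPolar`. -/
def quatFourier (k r n : R) (Φ : R × R × R × R → ℝ) (v : R × R × R × R) : ℂ :=
  ∑ w, (Φ w : ℂ) * φ (-quatPolar k r n v w)

lemma IsIsotropicChar.fourier_lowerMove (hΦ : IsIsotropicChar k r n Ψ Φ) (s₁ s₂ : R)
    (v : R × R × R × R) :
    quatFourier φ k r n Φ (_root_.lowerMove k r n s₁ s₂ v) = quatFourier φ k r n Φ v := by
  rw [quatFourier, ← (lowerMove_bijective k r n s₁ s₂).sum_comp]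
  simp only [quatPolar_lowerMove, hΦ.lowerMove]
  rfl

lemma fourier_swapMove (v : R × R × R × R) :
    quatFourier φ k r n (fun v => Φ (swapMove v)) (swapMove v) = quatFourier φ k r n Φ v := by
  rw [quatFourier, quatFourier,
    ← (Function.Involutive.bijective (f := swapMove (R := R)) swapMove_swapMove).sum_comp]
  simp only [quatPolar_swapMove, swapMove_swapMove]

lemma IsIsotropicChar.fourier_smul (hΨ : IsRealRingChar Ψ) (hΦ : IsIsotropicChar k r n Ψ Φ) {u : R}
    (hu : IsUnit u) (v : R × R × R × R) :
    quatFourier φ k r n Φ v = Ψ u * quatFourier φ k r n Φ (u • v) := by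
  have hb : Function.Bijective (fun v : R × R × R × R => u • v) :=
    MulAction.bijective hu.unit
  rw [quatFourier, ← hb.sum_comp, quatFourier, Finset.mul_sum]
  refine Finset.sum_congr rfl fun w _ => ?_
  rw [hΦ.smul hΨ hu, quatPolar_smul_right, quatPolar_smul_left]
  push_cast
  ring

lemma IsIsotropicChar.fourier_of_isotropic (hΨ : IsRealRingChar Ψ)
    (hΦ : IsIsotropicChar k r n Ψ Φ) {v : R × R × R × R} (hv : quatForm k r n v = 0) :
    quatFourier φ k r n Φ v = Φ v * quatFourier φ k r n Φ (1, 0, 0, 0) := by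
  by_cases h0 : Φ v = 0
  · obtain ⟨u, hu, hΨu, hw⟩ := hΦ.degenerate v hv h0
    have h1 := hΦ.fourier_smul φ hΨ hu v
    have h2 : quatFourier φ k r n Φ (u • v) = quatFourier φ k r n Φ v := by
      refine Finset.sum_congr rfl fun w _ => ?_
      have := hw w
      rw [quatPolar_smul_left, show u * quatPolar k r n v w = quatPolar k r n v w by
        linear_combination this]
    rw [h2, hΨu] at h1
    push_cast at h1
    rw [h0, Complex.ofReal_zero, zero_mul]
    linear_combination h1 / 2
  · obtain ⟨x₁, x₂, hx⟩ := hΦ.exists_left v h0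
    have hΦv := hΦ.left v x₁ x₂ hv hx
    rw [← quatForm_lowerMove k r n x₁ x₂] at hv
    rw [← hΦ.fourier_lowerMove φ x₁ x₂, hΦv]
    generalize _root_.lowerMove k r n x₁ x₂ v = w at hv hx
    obtain ⟨a, h, t, c⟩ := w
    obtain ⟨u, rfl⟩ := hx
    rw [← fourier_swapMove, ← hΦ.swap.fourier_lowerMove φ (-u⁻¹ * h) (-u⁻¹ * t)]
    have hu : (u : R) * (u⁻¹ : Rˣ) = 1 := u.mul_inv
    have h1 : _root_.lowerMove k r n (-u⁻¹ * h) (-u⁻¹ * t) (swapMove ((u : R), h, t, c)) =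
        swapMove ((u : R) • (1, 0, 0, 0)) := by
      have h2 : h + u * (-u⁻¹ * h) = 0 := by linear_combination -h * hu
      have h3 : t + u * (-u⁻¹ * t) = 0 := by linear_combination -t * hu
      have h4 : c + binPolar k r n h t (-u⁻¹ * h) (-u⁻¹ * t) +
          u * binForm k r n (-u⁻¹ * h) (-u⁻¹ * t) = 0 := by
        simp only [quatForm, binForm, binPolar] at hv ⊢
        linear_combination -(u⁻¹ : Rˣ) * hv +
          ((u⁻¹ : Rˣ) * (k * h ^ 2 + r * h * t + n * t ^ 2) - c) * hu
      simp only [_root_.lowerMove, swapMove, h2, h3, h4, Prod.smul_mk, smul_eq_mul, mul_one,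
        mul_zero]
    rw [h1, fourier_swapMove, hΦ.fourier_smul φ hΨ u.isUnit (1, 0, 0, 0), ← mul_assoc]
    rcases hΨ.sq _ u.isUnit with h2 | h2 <;> simp [h2]

end Fourier
end Isotropic

section Parseval
variable {R : Type} [CommRing R] [Fintype R] {k r n : R} {Ψ : R → ℝ} {Φ : R × R × R × R → ℝ}
  (φ : AddChar R ℂ)

lemma IsIsotropicChar.sum_first_coord (hΨ : IsRealRingChar Ψ) (hΦ : IsIsotropicChar k r n Ψ Φ)
    (x : R) : ∑ w : R × R × R, Φ (x, w) = (Fintype.card R : ℝ) ^ 2 * Ψ x := by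
  by_cases hx : IsUnit x
  · obtain ⟨x, rfl⟩ := hx
    have h : ∀ h t c : R, Φ (x, h, t, c) = if (x⁻¹ : Rˣ) * binForm k r n h t = c then Ψ x else 0 := by
      intro h t c
      have hq : (x⁻¹ : Rˣ) * binForm k r n h t = c ↔ quatForm k r n ((x : R), h, t, c) = 0 := by
        rw [Units.inv_mul_eq_iff_eq_mul, quatForm, sub_eq_zero]
      rw [hq]
      split_ifs with h1
      · have := hΦ.left _ 0 0 h1
        rw [lowerMove_zero] at this
        exact this x.isUnit
      · exact hΦ.supp _ h1
    simp only [Fintype.sum_prod_type, h, Finset.sum_ite_eq, Finset.mem_univ, if_true,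
      Finset.sum_const, Finset.card_univ, nsmul_eq_mul]
    ring
  · rw [hΨ.nonunit x hx, mul_zero]
    obtain ⟨u, hu, hΨu, hux⟩ := hΨ.prim x hx
    have hb : Function.Bijective (fun v : R × R × R => u • v) := MulAction.bijective hu.unit
    have h : ∑ w : R × R × R, Φ (x, w) = - ∑ w : R × R × R, Φ (x, w) := by
      nth_rewrite 1 [← hb.sum_comp]
      rw [← Finset.sum_neg_distrib]
      refine Finset.sum_congr rfl fun w _ => ?_
      have h1 := hΦ.smul hΨ hu (x, w)
      rw [Prod.smul_mk, smul_eq_mul, hux, hΨu] at h1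
      rw [h1, neg_one_mul]
    linarith

lemma IsIsotropicChar.fourier_base (hΨ : IsRealRingChar Ψ) (hΦ : IsIsotropicChar k r n Ψ Φ) :
    quatFourier φ k r n Φ (1, 0, 0, 0) =
      (Fintype.card R : ℂ) ^ 2 * ∑ x, (Ψ x : ℂ) * φ x := by
  rw [← fourier_swapMove, quatFourier, Fintype.sum_prod_type, Finset.mul_sum]
  refine Finset.sum_congr rfl fun x _ => ?_
  have h : ∀ w : R × R × R, φ (-quatPolar k r n (swapMove (1, 0, 0, 0)) (x, w)) = φ x := by
    intro w
    simp [quatPolar, swapMove, binPolar]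
  simp only [h]
  rw [← Finset.sum_mul, ← Complex.ofReal_sum, hΦ.swap.sum_first_coord hΨ]
  push_cast
  ring

lemma sum_quatPolar (hφ : φ.IsPrimitive) (w : R × R × R × R) :
    ∑ v, φ (quatPolar k r n v w) =
      if ∀ v, quatPolar k r n v w = 0 then (Fintype.card R : ℂ) ^ 4 else 0 := by
  have h := AddChar.sum_eq_ite (φ.compAddMonoidHom (quatPolarHom k r n w))
  have h0 : φ.compAddMonoidHom (quatPolarHom k r n w) = 0 ↔ ∀ v, quatPolar k r n v w = 0 := by
    constructor
    · intro h1 v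
      by_contra hv
      refine hφ hv ?_
      ext x
      have := DFunLike.congr_fun h1 (x • v)
      rw [AddChar.mulShift_apply, mul_comm, ← quatPolar_smul_left]
      exact this
    · intro h1
      ext v
      change φ (quatPolar k r n v w) = 1
      rw [h1, AddChar.map_zero_eq_one]
  rw [if_congr h0 rfl rfl] at h
  refine Eq.trans ?_ (h.trans ?_)
  · rfl
  · simp only [Fintype.card_prod]
    push_cast
    congr 1
    ring

lemma sum_normSq_quatFourier_le (hφ : φ.IsPrimitive) {B : ℕ}
    (hB : (Finset.univ.filter fun w : R × R × R × R => ∀ v, quatPolar k r n v w = 0).card ≤ B) :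
    ∑ v, Complex.normSq (quatFourier φ k r n Φ v) ≤
      (Fintype.card R : ℝ) ^ 4 * B * ∑ v, Φ v ^ 2 := by
  have h1 : ((∑ v, Complex.normSq (quatFourier φ k r n Φ v) : ℝ) : ℂ) =
      ((∑ w, ∑ w', Φ w * Φ w' * (if ∀ v, quatPolar k r n v (w' - w) = 0 then
        (Fintype.card R : ℝ) ^ 4 else 0) : ℝ) : ℂ) := by
    push_cast
    have h2 : ∀ v, (Complex.normSq (quatFourier φ k r n Φ v) : ℂ) =
        ∑ w, ∑ w', (Φ w : ℂ) * Φ w' * φ (quatPolar k r n v (w' - w)) := by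
      intro v
      rw [← Complex.mul_conj, quatFourier, map_sum, Finset.sum_mul_sum]
      refine Finset.sum_congr rfl fun w _ => Finset.sum_congr rfl fun w' _ => ?_
      rw [map_mul, Complex.conj_ofReal, ← AddChar.map_neg_eq_conj, neg_neg, quatPolar_sub_right,
        sub_eq_add_neg, AddChar.map_add_eq_mul]
      ring
    simp only [h2]
    rw [Finset.sum_comm]
    refine Finset.sum_congr rfl fun w _ => ?_
    rw [Finset.sum_comm]
    refine Finset.sum_congr rfl fun w' _ => ?_
    rw [← Finset.mul_sum, sum_quatPolar φ hφ]
    simp only [apply_ite (Complex.ofReal), Complex.ofReal_pow, Complex.ofReal_natCast,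
      Complex.ofReal_zero]
  have h1' := Complex.ofReal_injective h1
  set Q := (Fintype.card R : ℝ) ^ 4 with hQ
  have hQ0 : 0 ≤ Q := by positivity
  set rad := Finset.univ.filter fun w : R × R × R × R => ∀ v, quatPolar k r n v w = 0 with hrad
  have h3 : ∀ w : R × R × R × R, ∑ w', (if ∀ v, quatPolar k r n v (w' - w) = 0 then Q else 0) =
      rad.card * Q := by
    intro w
    rw [← Equiv.sum_comp (Equiv.addRight w)]
    simp only [Equiv.coe_addRight, add_sub_cancel_right]
    rw [← Finset.sum_filter, Finset.sum_const, nsmul_eq_mul]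
  have h3' : ∀ w' : R × R × R × R, ∑ w, (if ∀ v, quatPolar k r n v (w' - w) = 0 then Q else 0) =
      rad.card * Q := by
    intro w
    rw [← Equiv.sum_comp (Equiv.subLeft w)]
    simp only [Equiv.subLeft_apply, sub_sub_cancel]
    rw [← Finset.sum_filter, Finset.sum_const, nsmul_eq_mul]
  rw [h1']
  calc _ ≤ ∑ w, ∑ w', (Φ w ^ 2 / 2 * (if ∀ v, quatPolar k r n v (w' - w) = 0 then Q else 0) +
        Φ w' ^ 2 / 2 * (if ∀ v, quatPolar k r n v (w' - w) = 0 then Q else 0)) := by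
        refine Finset.sum_le_sum fun w _ => Finset.sum_le_sum fun w' _ => ?_
        rw [← add_mul]
        refine mul_le_mul_of_nonneg_right ?_ (by split_ifs <;> simp [hQ0])
        nlinarith [sq_nonneg (Φ w - Φ w')]
    _ = rad.card * Q * ∑ v, Φ v ^ 2 := by
        simp only [Finset.sum_add_distrib]
        rw [Finset.sum_comm (f := fun w w' => Φ w' ^ 2 / 2 * _)]
        simp only [← Finset.mul_sum, h3, h3']
        simp only [← Finset.sum_mul, ← Finset.sum_div]
        ring
    _ ≤ Q * B * ∑ v, Φ v ^ 2 := by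
        have : (rad.card : ℝ) ≤ B := by exact_mod_cast hB
        rw [mul_comm (rad.card : ℝ)]
        gcongr

/-- The Fourier transform of an isotropic character is a multiple of itself. -/
theorem IsIsotropicChar.fourier_eq (hφ : φ.IsPrimitive) (hΨ : IsRealRingChar Ψ)
    (hΦ : IsIsotropicChar k r n Ψ Φ)
    (hB : (Finset.univ.filter fun w : R × R × R × R => ∀ v, quatPolar k r n v w = 0).card ≤
      Fintype.card R)
    (hτ : Complex.normSq (∑ x, (Ψ x : ℂ) * φ x) = Fintype.card R) (v : R × R × R × R) :
    quatFourier φ k r n Φ v =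
      Φ v * ((Fintype.card R : ℂ) ^ 2 * ∑ x, (Ψ x : ℂ) * φ x) := by
  rw [← hΦ.fourier_base φ hΨ]
  by_cases hv : quatForm k r n v = 0
  · exact hΦ.fourier_of_isotropic φ hΨ hv
  · rw [hΦ.supp v hv, Complex.ofReal_zero, zero_mul, ← Complex.normSq_eq_zero]
    have hle := sum_normSq_quatFourier_le (Φ := Φ) φ hφ hB
    have h1 : ∀ w, Φ w ^ 2 * (Fintype.card R : ℝ) ^ 5 =
        if quatForm k r n w = 0 then Complex.normSq (quatFourier φ k r n Φ w) else 0 := by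
      intro w
      split_ifs with hw
      · rw [hΦ.fourier_of_isotropic φ hΨ hw, hΦ.fourier_base φ hΨ, Complex.normSq_mul,
          Complex.normSq_mul, hτ, map_pow, Complex.normSq_ofReal, Complex.normSq_natCast]
        ring
      · rw [hΦ.supp w hw]; ring
    have h2 : ∑ w, Complex.normSq (quatFourier φ k r n Φ w) ≤
        ∑ w, if quatForm k r n w = 0 then Complex.normSq (quatFourier φ k r n Φ w) else 0 := by
      refine hle.trans (le_of_eq ?_)
      rw [← Finset.sum_congr rfl fun w _ => h1 w, ← Finset.sum_mul]
      ring
    rw [← sub_nonneg, ← Finset.sum_sub_distrib] at h2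
    have h3 : ∀ w ∈ Finset.univ, (if quatForm k r n w = 0 then
        Complex.normSq (quatFourier φ k r n Φ w) else 0) -
        Complex.normSq (quatFourier φ k r n Φ w) ≤ 0 := by
      intro w _
      have := Complex.normSq_nonneg (quatFourier φ k r n Φ w)
      split_ifs <;> linarith
    have h4 := (Finset.sum_eq_zero_iff_of_nonpos h3).mp
      (le_antisymm (Finset.sum_nonpos h3) h2) v (Finset.mem_univ v)
    rw [if_neg hv] at h4
    linarith

end Parseval

lemma Int.gcd_eq_one_of_forall_prime {n m : ℤ}
    (h : ∀ p : ℕ, p.Prime → (p : ℤ) ∣ m → ¬ (p : ℤ) ∣ n) : Int.gcd n m = 1 := by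
  by_contra hc
  obtain ⟨p, hp, h1, h2⟩ := Nat.Prime.not_coprime_iff_dvd.mp hc
  exact h p hp (Int.natCast_dvd.mpr h2) (Int.natCast_dvd.mpr h1)

lemma Int.not_dvd_of_gcd_eq_one {n m : ℤ} (h : Int.gcd n m = 1) {p : ℕ} (hp : p.Prime)
    (hm : (p : ℤ) ∣ m) : ¬ (p : ℤ) ∣ n := fun hn => by
  have := Int.dvd_coe_gcd hn hm
  rw [h] at this
  exact hp.one_lt.ne' (by exact_mod_cast Int.eq_one_of_dvd_one (by positivity) this)

lemma Int.gcd_eq_one_of_modEq {x y m : ℤ} (h : x ≡ y [ZMOD m]) (hx : Int.gcd x m = 1) :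
    Int.gcd y m = 1 := by
  refine Int.gcd_eq_one_of_forall_prime fun p hp hm hy => Int.not_dvd_of_gcd_eq_one hx hp hm ?_
  exact (dvd_iff_dvd_of_dvd_sub (hm.trans h.dvd)).mp hy

lemma exists_binary_gcd_eq_one (A B C : ℤ) {Δ : ℤ} (hΔ : Δ ≠ 0)
    (h : ∀ p : ℕ, p.Prime → (p : ℤ) ∣ Δ → (p : ℤ) ∣ A → (p : ℤ) ∣ B ∧ ¬ (p : ℤ) ∣ C) :
    ∃ σ : ℤ, Int.gcd (A + B * σ + C * σ ^ 2) Δ = 1 := by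
  refine ⟨∏ p ∈ Δ.natAbs.primeFactors.filter fun p : ℕ => ¬ (p : ℤ) ∣ A, (p : ℤ), ?_⟩
  set σ := ∏ p ∈ Δ.natAbs.primeFactors.filter fun p : ℕ => ¬ (p : ℤ) ∣ A, (p : ℤ) with hσ
  refine Int.gcd_eq_one_of_forall_prime fun p hp hpΔ hdvd => ?_
  have hpI : Prime (p : ℤ) := Nat.prime_iff_prime_int.mp hp
  by_cases hA : (p : ℤ) ∣ A
  · obtain ⟨hB, hC⟩ := h p hp hpΔ hA
    have h1 : (p : ℤ) ∣ C * σ ^ 2 := (Int.dvd_add_right (hA.add (hB.mul_right σ))).mp hdvd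
    rcases hpI.dvd_or_dvd h1 with h2 | h2
    · exact hC h2
    · obtain ⟨q, hq, hpq⟩ := (Prime.dvd_finsetProd_iff hpI _).mp (hpI.dvd_of_dvd_pow h2)
      rw [Finset.mem_filter, Nat.mem_primeFactors] at hq
      have := (Nat.prime_dvd_prime_iff_eq hp hq.1.1).mp (by exact_mod_cast hpq)
      exact hq.2 (this ▸ hA)
  · have hpσ : (p : ℤ) ∣ σ := by
      refine Finset.dvd_prod_of_mem (fun p : ℕ => (p : ℤ)) (Finset.mem_filter.mpr ⟨?_, hA⟩)
      exact Nat.mem_primeFactors.mpr ⟨hp, Int.natCast_dvd.mp hpΔ, Int.natAbs_ne_zero.mpr hΔ⟩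
    refine hA ((Int.dvd_add_left (hpσ.mul_left B)).mp ((Int.dvd_add_left ?_).mp hdvd))
    exact (dvd_pow hpσ two_ne_zero).mul_left C

lemma IsFundamentalDiscriminant.ne_zero {Δ : ℤ} (hΔ : IsFundamentalDiscriminant Δ) : Δ ≠ 0 := by
  rintro rfl
  rcases hΔ with h | h
  · exact absurd h.1 (by norm_num)
  · exact absurd h.2.2 (by norm_num)

lemma IsFundamentalDiscriminant.not_sq_dvd {Δ r M : ℤ} (hΔ : IsFundamentalDiscriminant Δ)
    (hd : Δ = r ^ 2 - 4 * M) {p : ℕ} (hp : p.Prime) (hpΔ : (p : ℤ) ∣ Δ) : ¬ (p : ℤ) ^ 2 ∣ M := by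
  intro hM
  have hpI : Prime (p : ℤ) := Nat.prime_iff_prime_int.mp hp
  have hr : (p : ℤ) ∣ r := by
    refine hpI.dvd_of_dvd_pow (n := 2) ?_
    rw [show r ^ 2 = Δ + 4 * M by rw [hd]; ring]
    exact hpΔ.add (((dvd_pow_self _ two_ne_zero).trans hM).mul_left 4)
  have h2 : (p : ℤ) ^ 2 ∣ Δ := by
    rw [hd]
    exact dvd_sub (pow_dvd_pow_of_dvd hr 2) (hM.mul_left 4)
  rcases hΔ with ⟨-, hsq⟩ | ⟨h4, hsq, hmod⟩
  · exact hpI.not_isUnit (hsq p (by rwa [← sq]))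
  · rcases hp.eq_two_or_odd' with rfl | hodd
    · obtain ⟨s, rfl⟩ := hr
      obtain ⟨w, rfl⟩ := hM
      have h0 : Δ = 4 * (s ^ 2 - 4 * w) := by rw [hd]; push_cast; ring
      have h5 : Δ / 4 = s ^ 2 - 4 * w := by omega
      rcases Int.even_or_odd' s with ⟨j, rfl | rfl⟩
      · have : Δ / 4 = 4 * (j ^ 2 - w) := by rw [h5]; ring
        omega
      · have : Δ / 4 = 4 * (j ^ 2 + j - w) + 1 := by rw [h5]; ring
        omega
    · refine hpI.not_isUnit (hsq p ?_)
      rw [← sq]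
      have h6 : Δ = 4 * (Δ / 4) := by omega
      rw [h6] at h2
      refine IsCoprime.dvd_of_dvd_mul_left ?_ h2
      rw [Int.isCoprime_iff_gcd_eq_one]
      have h7 : Nat.Coprime p 2 := hodd.coprime_two_right
      have h8 : Nat.Coprime (p ^ 2) (2 ^ 2) := Nat.Coprime.pow 2 2 h7
      simpa [Int.gcd, Int.natAbs_pow] using h8

lemma kronecker_eq_one {Δ β : ℤ} {m : ℕ} (hm : 0 < m) (hco : Int.gcd m Δ = 1)
    (h : Δ ≡ β ^ 2 [ZMOD 4 * m]) : kronecker Δ m = 1 := by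
  have h1 : ((m : ℤ) / 2 ^ m.factorization 2) = ((m / 2 ^ m.factorization 2 : ℕ) : ℤ) := by simp
  rw [kronecker, if_neg (by positivity), if_neg (by intro h; omega), Int.natAbs_natCast, one_mul]
  set o := m / 2 ^ m.factorization 2 with ho
  have hom : o ∣ m := Nat.ordCompl_dvd m 2
  have hJ : J(Δ | o) = 1 := by
    have h2 : Δ ≡ β ^ 2 [ZMOD o] :=
      h.of_dvd ((Int.natCast_dvd_natCast.mpr hom).mul_left 4)
    rw [jacobiSym.mod_left' h2]
    refine jacobiSym.sq_one' ?_
    have h3 : Int.gcd Δ o = 1 := by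
      rw [Int.gcd_comm]
      exact Nat.Coprime.coprime_dvd_left hom hco
    have h4 := Int.gcd_eq_one_of_modEq h2 h3
    exact Int.gcd_eq_one_of_forall_prime fun p hp hpo hpb =>
      Int.not_dvd_of_gcd_eq_one h4 hp hpo (dvd_pow hpb two_ne_zero)
  rw [hJ, mul_one]
  by_cases h2 : 2 ∣ m
  · have hΔ2 : ¬ (2 : ℤ) ∣ Δ := fun h3 =>
      Int.not_dvd_of_gcd_eq_one hco Nat.prime_two h3 (by exact_mod_cast h2)
    have h8 : Δ ≡ β ^ 2 [ZMOD 8] := by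
      refine h.of_dvd ?_
      obtain ⟨j, rfl⟩ := h2
      exact ⟨j, by push_cast; ring⟩
    have hβ : β % 2 = 1 := by
      by_contra hc
      obtain ⟨j, rfl⟩ : (2 : ℤ) ∣ β := by omega
      have : Δ % 8 = (4 * j ^ 2) % 8 := by rw [h8, mul_pow]; norm_num
      omega
    have h9 : β ^ 2 % 8 = 1 := by
      obtain ⟨j, rfl⟩ := Int.odd_iff.mpr hβ
      obtain ⟨i, hi⟩ := Int.even_mul_succ_self j
      have : (2 * j + 1) ^ 2 = 8 * i + 1 := by linear_combination 4 * hi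
      omega
    have : Δ % 8 = 1 := by rw [h8, h9]
    rw [kron2, if_neg (by omega), if_pos (Or.inl this), one_pow]
  · rw [Nat.factorization_eq_zero_of_not_dvd h2, pow_zero]

section DiscriminantChar
variable {N : ℕ} {Δ r k : ℤ} {ψ : ℤ → ℤ} {χ : ℤ → ℤ → ℤ → ℤ}

lemma IsGenusChar.kronecker_add (hχ : IsGenusChar N Δ χ) (hN : 0 < N) {n j : ℤ}
    (hn : Int.gcd n Δ = 1) : kronecker Δ (n + Δ * j) = kronecker Δ n := by
  have hm : Int.gcd (n + Δ * j) Δ = 1 := by simpa using hn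
  have hrep : ∀ m : ℤ, Int.gcd m Δ = 1 → χ m 0 0 = kronecker Δ m := fun m hm =>
    hχ.2.2 m 0 0 m ⟨by simp [QD], ⟨0, by simp [QD]⟩, by simpa [Int.gcd, Int.natAbs_abs] using hm⟩ hm
      ⟨1, N, 1, 0, by ring, one_pos, by exact_mod_cast hN, by ring⟩
  rw [← hrep _ hm, ← hrep _ hn]
  exact hχ.1 _ _ _ _ _ _ (by simp [Int.ModEq]) rfl rfl

lemma IsDiscriminantChar.eq_kronecker' (hψ : IsDiscriminantChar Δ ψ) (hΔ : Δ ≠ 0)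
    (hχ : IsGenusChar N Δ χ) (hN : 0 < N) {n : ℤ} (hn : Int.gcd n Δ = 1) :
    ψ n = kronecker Δ n := by
  rw [← hχ.kronecker_add hN (j := Δ * (|n| + 1)) hn, ← hψ.eq_kronecker]
  · exact hψ.char.congr _ _ (by simp [Int.ModEq])
  · have : 0 < Δ ^ 2 := by positivity
    have h2 := neg_abs_le n
    nlinarith [abs_nonneg n]
  · simpa using hn

lemma IsDiscriminantChar.congr (hψ : IsDiscriminantChar Δ ψ) {x y : ℤ} (h : x ≡ y [ZMOD Δ]) :
    ψ x = ψ y :=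
  hψ.char.congr _ _ (h.of_dvd (Int.natAbs_dvd.mpr dvd_rfl))

lemma IsDiscriminantChar.mul_self (hψ : IsDiscriminantChar Δ ψ) {x : ℤ} (h : Int.gcd x Δ = 1) :
    ψ x * ψ x = 1 := by
  rcases hψ.char.sq x (by rwa [Int.gcd, Int.natAbs_natCast]) with h1 | h1 <;> simp [h1]

lemma IsDiscriminantChar.eq_one_of_pos (hψ : IsDiscriminantChar Δ ψ) {A B C x y : ℤ}
    (hd : B ^ 2 - 4 * A * C = Δ) (hm : 0 < A * x ^ 2 + B * x * y + C * y ^ 2)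
    (hco : Int.gcd (A * x ^ 2 + B * x * y + C * y ^ 2) Δ = 1) :
    ψ (A * x ^ 2 + B * x * y + C * y ^ 2) = 1 := by
  have hg : 0 < Int.gcd x y := by
    rw [Nat.pos_iff_ne_zero, Ne, Int.gcd_eq_zero_iff]
    rintro ⟨rfl, rfl⟩
    simp at hm
  obtain ⟨g, x', y', hg0, hxy, rfl, rfl⟩ := Int.exists_gcd_one' hg
  obtain ⟨u, v, huv⟩ := (Int.isCoprime_iff_gcd_eq_one.mpr hxy)
  have h1 : A * (x' * g) ^ 2 + B * (x' * g) * (y' * g) + C * (y' * g) ^ 2 =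
      g * g * (A * x' ^ 2 + B * x' * y' + C * y' ^ 2) := by ring
  rw [h1] at hm hco ⊢
  set m := A * x' ^ 2 + B * x' * y' + C * y' ^ 2 with hm0
  have hmpos : 0 < m := pos_of_mul_pos_right hm (by positivity)
  have hgco : Int.gcd g Δ = 1 := Int.gcd_eq_one_of_forall_prime fun p hp h2 h3 =>
    Int.not_dvd_of_gcd_eq_one hco hp h2 ((h3.mul_right _).mul_right _)
  have hmco : Int.gcd m Δ = 1 := Int.gcd_eq_one_of_forall_prime fun p hp h2 h3 =>
    Int.not_dvd_of_gcd_eq_one hco hp h2 (h3.mul_left _)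
  rw [hψ.char.mul, hψ.char.mul, hψ.mul_self hgco, one_mul, hψ.eq_kronecker m hmpos hmco]
  clear_value m
  lift m to ℕ using hmpos.le
  refine kronecker_eq_one (β := -2 * A * x' * v + B * (x' * u - y' * v) + 2 * C * y' * u)
    (by exact_mod_cast hmpos) hmco ?_
  refine Int.modEq_iff_dvd.mpr ⟨A * v ^ 2 - B * v * u + C * u ^ 2, ?_⟩
  rw [hm0, ← hd]
  linear_combination (B ^ 2 - 4 * A * C) * (u * x' + v * y' + 1) * huv

lemma kronecker_neg {n : ℤ} (hΔ : 0 < Δ) : kronecker Δ (-n) = kronecker Δ n := by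
  simp only [kronecker, neg_eq_zero, Int.natAbs_neg, hΔ.not_gt, and_false]

lemma IsDiscriminantChar.eq_one_of_represented (hψ : IsDiscriminantChar Δ ψ) (hΔ : Δ ≠ 0)
    (hχ : IsGenusChar N Δ χ) (hN : 0 < N) {A B C x y : ℤ}
    (hd : B ^ 2 - 4 * A * C = Δ) (hpos : 0 < A ∨ 0 < C)
    (hco : Int.gcd (A * x ^ 2 + B * x * y + C * y ^ 2) Δ = 1) :
    ψ (A * x ^ 2 + B * x * y + C * y ^ 2) = 1 := by
  rcases lt_trichotomy 0 (A * x ^ 2 + B * x * y + C * y ^ 2) with h | h | h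
  · exact hψ.eq_one_of_pos hd h hco
  · rw [← h] at hco ⊢
    have h1 : Δ.natAbs = 1 := by simpa using hco
    rw [← hψ.char.one]
    exact hψ.char.congr _ _ (by rw [h1]; exact Int.modEq_one)
  · rcases hΔ.lt_or_gt with hneg | hΔpos
    · exfalso
      rcases hpos with hA | hC
      · nlinarith [sq_nonneg (2 * A * x + B * y), mul_nonneg (neg_nonneg.mpr hneg.le) (sq_nonneg y)]
      · nlinarith [sq_nonneg (2 * C * y + B * x), mul_nonneg (neg_nonneg.mpr hneg.le) (sq_nonneg x)]
    · have h1 : -(A * x ^ 2 + B * x * y + C * y ^ 2) = -A * x ^ 2 + -B * x * y + -C * y ^ 2 := by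
        ring
      have hco' : Int.gcd (-(A * x ^ 2 + B * x * y + C * y ^ 2)) Δ = 1 := by rwa [Int.neg_gcd]
      rw [hψ.eq_kronecker' hΔ hχ hN hco, ← kronecker_neg hΔpos,
        ← hψ.eq_kronecker' hΔ hχ hN hco', h1]
      exact hψ.eq_one_of_pos (by rw [← hd]; ring) (by rw [← h1]; linarith) (by rwa [← h1])

end DiscriminantChar

/-- A fundamental discriminant that is a square modulo `4N`, with its quadratic and genus
characters. -/
structure IsGenusSetting (N : ℕ) (Δ r k : ℤ) (ψ : ℤ → ℤ) (χ : ℤ → ℤ → ℤ → ℤ) : Prop where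
  pos : 0 < N
  disc : IsFundamentalDiscriminant Δ
  eq : Δ = r ^ 2 - 4 * (k * N)
  char : IsDiscriminantChar Δ ψ
  genus : IsGenusChar N Δ χ

namespace IsGenusSetting
variable {N : ℕ} {Δ r k : ℤ} {ψ : ℤ → ℤ} {χ : ℤ → ℤ → ℤ → ℤ} {a c h t s₁ s₂ : ℤ} {p : ℕ}

lemma dvd_of_dvd_binForm (S : IsGenusSetting N Δ r k ψ χ) (hp : p.Prime) (hpΔ : (p : ℤ) ∣ Δ)
    (hq : (p : ℤ) ∣ binForm k r N h t) :
    (p : ℤ) ∣ r * h + 2 * N * t ∧ (p : ℤ) ∣ 2 * k * h + r * t := by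
  have hpI : Prime (p : ℤ) := Nat.prime_iff_prime_int.mp hp
  constructor <;> refine hpI.dvd_of_dvd_pow (n := 2) ?_
  · rw [show (r * h + 2 * N * t) ^ 2 = Δ * h ^ 2 + 4 * N * binForm k r N h t by
      rw [S.eq, binForm]; ring]
    exact (hpΔ.mul_right _).add (hq.mul_left _)
  · rw [show (2 * k * h + r * t) ^ 2 = Δ * t ^ 2 + 4 * k * binForm k r N h t by
      rw [S.eq, binForm]; ring]
    exact (hpΔ.mul_right _).add (hq.mul_left _)

lemma dvd_binPolar (S : IsGenusSetting N Δ r k ψ χ) (hp : p.Prime) (hpΔ : (p : ℤ) ∣ Δ)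
    (hq : (p : ℤ) ∣ binForm k r N h t) (s₁ s₂ : ℤ) : (p : ℤ) ∣ binPolar k r N h t s₁ s₂ := by
  obtain ⟨h1, h2⟩ := S.dvd_of_dvd_binForm hp hpΔ hq
  rw [show binPolar k r N h t s₁ s₂ = (2 * k * h + r * t) * s₁ + (r * h + 2 * N * t) * s₂ by
    rw [binPolar]; ring]
  exact (h2.mul_right _).add (h1.mul_right _)

lemma dvd_binForm_iff (hpΔ : (p : ℤ) ∣ Δ) (hac : a * c ≡ binForm k r N h t [ZMOD Δ]) :
    (p : ℤ) ∣ a * c ↔ (p : ℤ) ∣ binForm k r N h t :=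
  (dvd_iff_dvd_of_dvd_sub (hpΔ.trans hac.symm.dvd))

lemma not_dvd_of_coprime (S : IsGenusSetting N Δ r k ψ χ) (hp : p.Prime) (hpΔ : (p : ℤ) ∣ Δ)
    (hac : a * c ≡ binForm k r N h t [ZMOD Δ])
    (hf : Int.gcd (a + binPolar k r N h t s₁ s₂ + c * binForm k r N s₁ s₂) Δ = 1) :
    ¬ ((p : ℤ) ∣ a ∧ (p : ℤ) ∣ c) := fun ⟨ha, hc⟩ => by
  have hq := (dvd_binForm_iff hpΔ hac).mp (ha.mul_right c)
  exact Int.not_dvd_of_gcd_eq_one hf hp hpΔ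
    ((ha.add (S.dvd_binPolar hp hpΔ hq _ _)).add (hc.mul_right _))

lemma not_dvd_and_dvd (S : IsGenusSetting N Δ r k ψ χ) {A B : ℤ} (hp : p.Prime)
    (hpΔ : (p : ℤ) ∣ Δ) (hAB : A * B ∣ k * N) (hA : (p : ℤ) ∣ A) : ¬ (p : ℤ) ∣ B := fun hB =>
  S.disc.not_sq_dvd S.eq hp hpΔ (by rw [sq]; exact (mul_dvd_mul hA hB).trans hAB)

/-- Away from the degenerate vectors, the genus character is defined by a represented value
coprime to the discriminant. -/
lemma exists_represented (S : IsGenusSetting N Δ r k ψ χ)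
    (hac : a * c ≡ binForm k r N h t [ZMOD Δ])
    (hnd : ∀ p : ℕ, p.Prime → (p : ℤ) ∣ Δ → ¬ ((p : ℤ) ∣ a ∧ (p : ℤ) ∣ c)) :
    ∃ N₁ N₂ X Y : ℤ, N₁ * N₂ = N ∧ 0 < N₁ ∧ 0 < N₂ ∧
      Int.gcd (N₁ * a * X ^ 2 + (r * h + 2 * N * t) * X * Y + N₂ * c * Y ^ 2) Δ = 1 ∧
      χ a (r * h + 2 * N * t) c =
        ψ (N₁ * a * X ^ 2 + (r * h + 2 * N * t) * X * Y + N₂ * c * Y ^ 2) := by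
  have hN := S.pos
  have hNI : (0 : ℤ) < N := by exact_mod_cast hN
  obtain ⟨N₂, hN₂⟩ := Int.gcd_dvd_left (N : ℤ) a
  have hN₁ : (0 : ℤ) < Int.gcd N a := by
    exact_mod_cast Int.gcd_pos_of_ne_zero_left a hNI.ne'
  have hN₂pos : 0 < N₂ := pos_of_mul_pos_right (hN₂ ▸ hNI) hN₁.le
  obtain ⟨σ, hσ⟩ := exists_binary_gcd_eq_one (Int.gcd N a * a) (r * h + 2 * N * t) (N₂ * c)
    S.disc.ne_zero (fun p hp hpΔ hpa => by
      have hpI : Prime (p : ℤ) := Nat.prime_iff_prime_int.mp hp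
      have ha : (p : ℤ) ∣ a := by
        rcases hpI.dvd_or_dvd hpa with h1 | h1
        · exact h1.trans (Int.gcd_dvd_right _ _)
        · exact h1
      refine ⟨(S.dvd_of_dvd_binForm hp hpΔ ((dvd_binForm_iff hpΔ hac).mp (ha.mul_right c))).1, ?_⟩
      intro h2
      rcases hpI.dvd_or_dvd h2 with h3 | h3
      · have h4 : (p : ℤ) ∣ Int.gcd N a :=
          Int.dvd_coe_gcd (hN₂ ▸ h3.mul_left _) ha
        exact S.not_dvd_and_dvd hp hpΔ (by rw [← hN₂]; exact dvd_mul_left _ _) h4 h3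
      · exact hnd p hp hpΔ ⟨ha, h3⟩)
  refine ⟨Int.gcd N a, N₂, 1, σ, hN₂.symm, hN₁, hN₂pos, by simpa using hσ, ?_⟩
  have hσ' : Int.gcd (Int.gcd N a * a * 1 ^ 2 + (r * h + 2 * N * t) * 1 * σ + N₂ * c * σ ^ 2) Δ
    = 1 := by simpa using hσ
  rw [S.char.eq_kronecker' S.disc.ne_zero S.genus hN hσ']
  obtain ⟨j, hj⟩ := hac.dvd
  have hQD : QD N a (r * h + 2 * N * t) c = Δ * (h ^ 2 + 4 * N * j) := by
    rw [binForm] at hj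
    rw [QD]
    linear_combination h ^ 2 * -S.eq + 4 * N * hj
  refine S.genus.2.2 _ _ _ _ ⟨⟨_, hQD⟩, ⟨h, ?_⟩, ?_⟩ hσ' ⟨Int.gcd N a, N₂, 1, σ, hN₂.symm, hN₁,
    hN₂pos, rfl⟩
  · rw [hQD, Int.mul_ediv_cancel_left _ S.disc.ne_zero]
    simp [Int.ModEq]
  · refine Int.gcd_eq_one_of_forall_prime fun p hp hpΔ h1 => ?_
    have h2 := Int.dvd_coe_gcd_iff.mp h1
    exact hnd p hp hpΔ ⟨(Int.dvd_coe_gcd_iff.mp h2.1).1, h2.2⟩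

lemma eq_left (S : IsGenusSetting N Δ r k ψ χ) (hac : a * c ≡ binForm k r N h t [ZMOD Δ])
    (hf : Int.gcd (a + binPolar k r N h t s₁ s₂ + c * binForm k r N s₁ s₂) Δ = 1) :
    χ a (r * h + 2 * N * t) c =
      ψ (a + binPolar k r N h t s₁ s₂ + c * binForm k r N s₁ s₂) := by
  obtain ⟨N₁, N₂, X, Y, hN, h1, h2, hco, hχ⟩ :=
    S.exists_represented hac fun p hp hpΔ => S.not_dvd_of_coprime hp hpΔ hac hf
  rw [hχ]
  set n := N₁ * a * X ^ 2 + (r * h + 2 * N * t) * X * Y + N₂ * c * Y ^ 2 with hn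
  set f := a + binPolar k r N h t s₁ s₂ + c * binForm k r N s₁ s₂ with hfdef
  obtain ⟨j, hj⟩ := hac.dvd
  set p := a * X + N₂ * t * Y
  set q := h * Y
  set w := N₁ * t * X + c * Y
  set U := p + (w * s₂ * N₂ + h * X * r * s₂ + h * X * s₁ * k)
  set W := q + (w * s₁ - h * X * s₂ * N₁)
  have hrep : n * f ≡ N₁ * U ^ 2 + r * U * W + N₂ * k * W ^ 2 [ZMOD Δ] := by
    refine (Int.modEq_iff_dvd.mpr ⟨j * (N₁ * N₁ * N₂ * X * X * s₂ * s₂ - 2 * N₁ * N₂ * X * Y * s₂ +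
      N₁ * X * X * k * s₁ * s₁ + N₁ * X * X * r * s₁ * s₂ + N₂ * Y * Y - X * Y * r * s₁), ?_⟩)
    rw [← mul_assoc, ← hj]
    simp only [n, f, U, W, w, p, q, binPolar, binForm, ← hN]
    ring
  have hnf : Int.gcd (n * f) Δ = 1 := Int.gcd_eq_one_of_forall_prime fun p hp hpΔ hd =>
    (Nat.prime_iff_prime_int.mp hp).dvd_or_dvd hd |>.elim
      (Int.not_dvd_of_gcd_eq_one hco hp hpΔ) (Int.not_dvd_of_gcd_eq_one hf hp hpΔ)
  have h3 := S.char.eq_one_of_represented S.disc.ne_zero S.genus S.pos (A := N₁) (B := r)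
    (C := N₂ * k) (by rw [S.eq, ← hN]; ring) (Or.inl h1) (Int.gcd_eq_one_of_modEq hrep hnf)
  rw [← S.char.congr hrep, S.char.char.mul] at h3
  have h4 := S.char.mul_self hf
  linear_combination ψ f * h3 - ψ n * h4

lemma eq_right (S : IsGenusSetting N Δ r k ψ χ) (hac : a * c ≡ binForm k r N h t [ZMOD Δ])
    (hf : Int.gcd (c + binPolar k r N h t s₁ s₂ + a * binForm k r N s₁ s₂) Δ = 1) :
    χ a (r * h + 2 * N * t) c =
      ψ (c + binPolar k r N h t s₁ s₂ + a * binForm k r N s₁ s₂) := by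
  obtain ⟨N₁, N₂, X, Y, hN, h1, h2, hco, hχ⟩ :=
    S.exists_represented hac fun p hp hpΔ hpac =>
      S.not_dvd_of_coprime hp hpΔ (mul_comm a c ▸ hac) hf hpac.symm
  rw [hχ]
  set n := N₁ * a * X ^ 2 + (r * h + 2 * N * t) * X * Y + N₂ * c * Y ^ 2 with hn
  set f := c + binPolar k r N h t s₁ s₂ + a * binForm k r N s₁ s₂ with hfdef
  obtain ⟨j, hj⟩ := hac.dvd
  set p := a * X + N₂ * t * Y
  set q := h * Y
  set U := h * X + (p * s₁ - N₂ * q * s₂)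
  set W := N₁ * t * X + c * Y + ((N₁ * p + q * r) * s₂ + q * k * s₁)
  have hrep : n * f ≡ N₁ * k * U ^ 2 + r * U * W + N₂ * W ^ 2 [ZMOD Δ] := by
    refine (Int.modEq_iff_dvd.mpr ⟨j * (N₁ * N₂ * N₂ * Y * Y * s₂ * s₂ - 2 * N₁ * N₂ * X * Y * s₂ +
      N₁ * X * X + N₂ * Y * Y * k * s₁ * s₁ + N₂ * Y * Y * r * s₁ * s₂ - X * Y * r * s₁), ?_⟩)
    rw [← mul_assoc, ← hj]
    simp only [n, f, U, W, p, q, binPolar, binForm, ← hN]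
    ring
  have hnf : Int.gcd (n * f) Δ = 1 := Int.gcd_eq_one_of_forall_prime fun p hp hpΔ hd =>
    (Nat.prime_iff_prime_int.mp hp).dvd_or_dvd hd |>.elim
      (Int.not_dvd_of_gcd_eq_one hco hp hpΔ) (Int.not_dvd_of_gcd_eq_one hf hp hpΔ)
  have h3 := S.char.eq_one_of_represented S.disc.ne_zero S.genus S.pos (A := N₁ * k) (B := r)
    (C := N₂) (by rw [S.eq, ← hN]; ring) (Or.inr h2) (Int.gcd_eq_one_of_modEq hrep hnf)
  rw [← S.char.congr hrep, S.char.char.mul] at h3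
  have h4 := S.char.mul_self hf
  linear_combination ψ f * h3 - ψ n * h4

lemma eq_zero (S : IsGenusSetting N Δ r k ψ χ) (hac : a * c ≡ binForm k r N h t [ZMOD Δ])
    (hp : p.Prime) (hpΔ : (p : ℤ) ∣ Δ) (ha : (p : ℤ) ∣ a) (hc : (p : ℤ) ∣ c) :
    χ a (r * h + 2 * N * t) c = 0 := by
  refine S.genus.2.1 _ _ _ fun hcond => Int.not_dvd_of_gcd_eq_one hcond.2.2 hp hpΔ ?_
  exact Int.dvd_coe_gcd (Int.dvd_coe_gcd ha
    (S.dvd_of_dvd_binForm hp hpΔ ((dvd_binForm_iff hpΔ hac).mp (ha.mul_right c))).1) hc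

lemma exists_binForm_coprime (S : IsGenusSetting N Δ r k ψ χ) :
    ∃ s₁ s₂ : ℤ, Int.gcd (binForm k r N s₁ s₂) Δ = 1 := by
  obtain ⟨ρ, hρ⟩ := exists_binary_gcd_eq_one k r N S.disc.ne_zero fun p hp hpΔ hk => by
    refine ⟨?_, S.not_dvd_and_dvd hp hpΔ dvd_rfl hk⟩
    simpa using (S.dvd_of_dvd_binForm (h := 1) (t := 0) hp hpΔ (by simpa [binForm])).1
  exact ⟨1, ρ, by simpa [binForm] using hρ⟩

lemma exists_coprime (S : IsGenusSetting N Δ r k ψ χ) (hac : a * c ≡ binForm k r N h t [ZMOD Δ])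
    (hnd : ∀ p : ℕ, p.Prime → (p : ℤ) ∣ Δ → ¬ ((p : ℤ) ∣ a ∧ (p : ℤ) ∣ c)) :
    ∃ s₁ s₂, Int.gcd (a + binPolar k r N h t s₁ s₂ + c * binForm k r N s₁ s₂) Δ = 1 := by
  obtain ⟨s₁, s₂, hs⟩ := S.exists_binForm_coprime
  obtain ⟨σ, hσ⟩ := exists_binary_gcd_eq_one a (binPolar k r N h t s₁ s₂) (c * binForm k r N s₁ s₂)
    S.disc.ne_zero fun p hp hpΔ ha => by
      refine ⟨S.dvd_binPolar hp hpΔ ((dvd_binForm_iff hpΔ hac).mp (ha.mul_right c)) _ _, fun h1 => ?_⟩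
      rcases (Nat.prime_iff_prime_int.mp hp).dvd_or_dvd h1 with h2 | h2
      · exact hnd p hp hpΔ ⟨ha, h2⟩
      · exact Int.not_dvd_of_gcd_eq_one hs hp hpΔ h2
  refine ⟨σ * s₁, σ * s₂, ?_⟩
  rw [← hσ, binPolar, binPolar, binForm, binForm]
  ring_nf

end IsGenusSetting

/-- An integer-valued function of period `D`, as a real function on `ZMod D`. -/
def zmodFun (D : ℕ) (ψ : ℤ → ℤ) (x : ZMod D) : ℝ := ψ x.cast

/-- The genus character on isotropic quadruples over `ZMod D`. -/
def genusFun (D N : ℕ) (r k : ℤ) (χ : ℤ → ℤ → ℤ → ℤ)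
    (v : ZMod D × ZMod D × ZMod D × ZMod D) : ℝ :=
  if quatForm (k : ZMod D) r N v = 0 then
    χ v.1.cast (r * v.2.1.cast + 2 * N * v.2.2.1.cast) v.2.2.2.cast else 0

lemma intCast_eq_intCast_iff_natAbs {Δ x y : ℤ} :
    (x : ZMod Δ.natAbs) = y ↔ x ≡ y [ZMOD Δ] := by
  rw [ZMod.intCast_eq_intCast_iff, Int.modEq_iff_dvd, Int.modEq_iff_dvd, Int.natAbs_dvd]

lemma cast_intCast_modEq (Δ m : ℤ) : (m : ZMod Δ.natAbs).cast ≡ m [ZMOD Δ] := by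
  rw [← intCast_eq_intCast_iff_natAbs, ZMod.intCast_zmod_cast]

lemma isUnit_intCast_natAbs_iff {Δ x : ℤ} : IsUnit (x : ZMod Δ.natAbs) ↔ Int.gcd x Δ = 1 := by
  rw [ZMod.coe_int_isUnit_iff_isCoprime, Int.isCoprime_iff_gcd_eq_one, Int.gcd_comm]
  simp only [Int.gcd, Int.natAbs_natCast]

namespace IsDiscriminantChar
variable {Δ : ℤ} {ψ : ℤ → ℤ}

lemma zmodFun_intCast (hψ : IsDiscriminantChar Δ ψ) (m : ℤ) :
    zmodFun Δ.natAbs ψ m = ψ m := by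
  rw [zmodFun, hψ.congr (cast_intCast_modEq Δ m)]

lemma isUnit_of_ne_zero (hψ : IsDiscriminantChar Δ ψ) {x : ℤ} (h : ψ x ≠ 0) :
    IsUnit (x : ZMod Δ.natAbs) := by
  rw [isUnit_intCast_natAbs_iff]
  by_contra h1
  exact h (hψ.char.zero x (by rwa [Int.gcd, Int.natAbs_natCast]))

lemma isRealRingChar (hψ : IsDiscriminantChar Δ ψ) :
    IsRealRingChar (zmodFun Δ.natAbs ψ) where
  mul x y := by
    obtain ⟨x, rfl⟩ := ZMod.intCast_surjective x
    obtain ⟨y, rfl⟩ := ZMod.intCast_surjective y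
    rw [← Int.cast_mul, hψ.zmodFun_intCast, hψ.zmodFun_intCast, hψ.zmodFun_intCast,
      hψ.char.mul, Int.cast_mul]
  sq x hx := by
    obtain ⟨x, rfl⟩ := ZMod.intCast_surjective x
    rw [isUnit_intCast_natAbs_iff] at hx
    rw [hψ.zmodFun_intCast]
    rcases hψ.char.sq x (by rwa [Int.gcd, Int.natAbs_natCast]) with h | h <;> simp [h]
  nonunit x hx := by
    obtain ⟨x, rfl⟩ := ZMod.intCast_surjective x
    rw [hψ.zmodFun_intCast, Int.cast_eq_zero]
    by_contra h
    exact hx (hψ.isUnit_of_ne_zero h)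
  prim x hx := by
    obtain ⟨x, rfl⟩ := ZMod.intCast_surjective x
    rw [isUnit_intCast_natAbs_iff] at hx
    obtain ⟨p, hp, hpx, hpΔ⟩ := Nat.Prime.not_coprime_iff_dvd.mp hx
    obtain ⟨u, hu1, hu⟩ := hψ.char.prim p hp hpΔ
    refine ⟨u, hψ.isUnit_of_ne_zero (by simp [hu]), by rw [hψ.zmodFun_intCast, hu]; simp, ?_⟩
    rw [← Int.cast_mul, ZMod.intCast_eq_intCast_iff, Int.modEq_comm, Int.modEq_iff_dvd]
    have h1 := mul_dvd_mul hu1.symm.dvd (Int.natCast_dvd.mpr hpx)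
    rw [← Int.natCast_mul, Nat.div_mul_cancel hpΔ] at h1
    rwa [sub_one_mul] at h1

end IsDiscriminantChar

lemma card_binForm_radical_le {D : ℕ} [NeZero D] {k r N : ℤ}
    (hd : (D : ℤ) = r ^ 2 - 4 * (k * N) ∨ (D : ℤ) = -(r ^ 2 - 4 * (k * N))) :
    (Finset.univ.filter fun x : ZMod D × ZMod D =>
      2 * k * x.1 + r * x.2 = 0 ∧ r * x.1 + 2 * N * x.2 = 0).card ≤ D := by
  set K := Finset.univ.filter fun x : ZMod D × ZMod D =>
    2 * k * x.1 + r * x.2 = 0 ∧ r * x.1 + 2 * N * x.2 = 0 with hK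
  let A : ZMod D × ZMod D →+ ZMod D × ZMod D :=
    { toFun := fun x => (2 * N * x.1 - r * x.2, -r * x.1 + 2 * k * x.2)
      map_zero' := by simp
      map_add' := fun x y => by ext <;> simp <;> ring }
  have h1 : Nat.card A.ker * Nat.card A.range = D ^ 2 := by
    rw [← AddSubgroup.index_ker, AddSubgroup.card_mul_index, Nat.card_prod, Nat.card_zmod, sq]
  have h2 : K.card ≤ Nat.card A.ker := by
    rw [Nat.card_eq_fintype_card, ← Fintype.card_coe]
    refine Fintype.card_le_of_injective (fun x => ⟨(-x.1.2, x.1.1), ?_⟩) ?_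
    · have hx := (Finset.mem_filter.mp x.2).2
      rw [AddMonoidHom.mem_ker]
      ext
      · change 2 * (N : ZMod D) * -x.1.2 - r * x.1.1 = 0
        linear_combination -hx.2
      · change -(r : ZMod D) * -x.1.2 + 2 * k * x.1.1 = 0
        linear_combination hx.1
    · intro x y hxy
      simp only [Subtype.mk.injEq, Prod.mk.injEq, neg_inj] at hxy
      exact Subtype.ext (Prod.ext hxy.2 hxy.1)
  have h3 : K.card ≤ Nat.card A.range := by
    rw [Nat.card_eq_fintype_card, ← Fintype.card_coe]
    refine Fintype.card_le_of_injective (fun x => ⟨x.1, ?_⟩) ?_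
    · obtain ⟨⟨x, y⟩, hx⟩ := x
      have hx := (Finset.mem_filter.mp hx).2
      obtain ⟨x, rfl⟩ := ZMod.intCast_surjective x
      obtain ⟨y, rfl⟩ := ZMod.intCast_surjective y
      have hx1 : ((2 * k * x + r * y : ℤ) : ZMod D) = 0 := by push_cast; exact hx.1
      have hx2 : ((r * x + 2 * N * y : ℤ) : ZMod D) = 0 := by push_cast; exact hx.2
      rw [ZMod.intCast_zmod_eq_zero_iff_dvd] at hx1 hx2
      obtain ⟨i, hi⟩ := hx1
      obtain ⟨j, hj⟩ := hx2
      have hD : (D : ℤ) ≠ 0 := by exact_mod_cast NeZero.ne D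
      rcases hd with hd | hd
      · refine ⟨(-(i : ZMod D), -(j : ZMod D)), ?_⟩
        have e1 : 2 * N * -i - r * -j = x := by
          refine mul_left_cancel₀ hD ?_
          linear_combination 2 * N * hi - r * hj - x * hd
        have e2 : -r * -i + 2 * k * -j = y := by
          refine mul_left_cancel₀ hD ?_
          linear_combination 2 * k * hj - r * hi - y * hd
        change ((2 * N * -i - r * -j : ZMod D), (-r * -i + 2 * k * -j : ZMod D)) = ((x : ZMod D), (y : ZMod D))
        rw [← e1, ← e2]; push_cast; rfl
      · refine ⟨((i : ZMod D), (j : ZMod D)), ?_⟩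
        have e1 : 2 * N * i - r * j = x := by
          refine mul_left_cancel₀ hD ?_
          linear_combination -2 * N * hi + r * hj - x * hd
        have e2 : -r * i + 2 * k * j = y := by
          refine mul_left_cancel₀ hD ?_
          linear_combination -2 * k * hj + r * hi - y * hd
        change ((2 * N * i - r * j : ZMod D), (-r * i + 2 * k * j : ZMod D)) = ((x : ZMod D), (y : ZMod D))
        rw [← e1, ← e2]; push_cast; rfl
    · intro x y hxy
      exact Subtype.ext (Subtype.mk.inj hxy)
  by_contra hc
  nlinarith [mul_le_mul h2 h3 (Nat.zero_le _) (Nat.zero_le _)]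

namespace IsGenusSetting
variable {N : ℕ} {Δ r k : ℤ} {ψ : ℤ → ℤ} {χ : ℤ → ℤ → ℤ → ℤ}

lemma quatForm_eq_zero_iff (a h t c : ℤ) :
    quatForm (k : ZMod Δ.natAbs) r N ((a : ZMod Δ.natAbs), (h : ZMod Δ.natAbs), (t : ZMod Δ.natAbs),
      (c : ZMod Δ.natAbs)) = 0 ↔ a * c ≡ binForm k r N h t [ZMOD Δ] := by
  rw [← intCast_eq_intCast_iff_natAbs, quatForm, sub_eq_zero, eq_comm, binForm, binForm]
  push_cast
  rfl

lemma binForm_congr {h h' t t' : ℤ} (hh : h ≡ h' [ZMOD Δ]) (ht : t ≡ t' [ZMOD Δ]) :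
    binForm k r N h t ≡ binForm k r N h' t' [ZMOD Δ] := by
  simp only [binForm]
  gcongr

lemma binPolar_congr {h h' t t' : ℤ} (hh : h ≡ h' [ZMOD Δ]) (ht : t ≡ t' [ZMOD Δ]) (s₁ s₂ : ℤ) :
    binPolar k r N h t s₁ s₂ ≡ binPolar k r N h' t' s₁ s₂ [ZMOD Δ] := by
  simp only [binPolar]
  gcongr

lemma genusChar_congr (S : IsGenusSetting N Δ r k ψ χ) {a a' h h' t t' c c' : ℤ}
    (hac : a * c ≡ binForm k r N h t [ZMOD Δ]) (ha : a ≡ a' [ZMOD Δ]) (hc : c ≡ c' [ZMOD Δ])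
    (hq : binForm k r N h t ≡ binForm k r N h' t' [ZMOD Δ])
    (hB : ∀ s₁ s₂, binPolar k r N h t s₁ s₂ ≡ binPolar k r N h' t' s₁ s₂ [ZMOD Δ]) :
    χ a (r * h + 2 * N * t) c = χ a' (r * h' + 2 * N * t') c' := by
  have hac' : a' * c' ≡ binForm k r N h' t' [ZMOD Δ] := ((ha.mul hc).symm.trans hac).trans hq
  by_cases hnd : ∀ p : ℕ, p.Prime → (p : ℤ) ∣ Δ → ¬ ((p : ℤ) ∣ a ∧ (p : ℤ) ∣ c)
  · obtain ⟨s₁, s₂, hs⟩ := S.exists_coprime hac hnd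
    have hff : a + binPolar k r N h t s₁ s₂ + c * binForm k r N s₁ s₂ ≡
        a' + binPolar k r N h' t' s₁ s₂ + c' * binForm k r N s₁ s₂ [ZMOD Δ] :=
      (ha.add (hB s₁ s₂)).add (hc.mul_right _)
    rw [S.eq_left hac hs, S.eq_left hac' (Int.gcd_eq_one_of_modEq hff hs), S.char.congr hff]
  · push Not at hnd
    obtain ⟨p, hp, hpΔ, hpa, hpc⟩ := hnd
    rw [S.eq_zero hac hp hpΔ hpa hpc, S.eq_zero hac' hp hpΔ
      ((dvd_iff_dvd_of_dvd_sub (hpΔ.trans ha.symm.dvd)).mp hpa)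
      ((dvd_iff_dvd_of_dvd_sub (hpΔ.trans hc.symm.dvd)).mp hpc)]

lemma genusFun_intCast (S : IsGenusSetting N Δ r k ψ χ) (a h t c : ℤ) :
    genusFun Δ.natAbs N r k χ (a, h, t, c) =
      if a * c ≡ binForm k r N h t [ZMOD Δ] then (χ a (r * h + 2 * N * t) c : ℝ) else 0 := by
  rw [genusFun, if_congr (quatForm_eq_zero_iff a h t c) rfl rfl]
  split_ifs with hac
  · have hh := (cast_intCast_modEq Δ h).symm
    have ht := (cast_intCast_modEq Δ t).symm
    rw [S.genusChar_congr hac (cast_intCast_modEq Δ a).symm (cast_intCast_modEq Δ c).symm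
      (binForm_congr hh ht) (binPolar_congr hh ht)]
  · rfl

lemma genusFun_shift (S : IsGenusSetting N Δ r k ψ χ) (a h t c : ℤ) :
    genusFun Δ.natAbs N r k χ (a, (h + r : ℤ), (t + -(2 * k) : ℤ), c) =
      genusFun Δ.natAbs N r k χ (a, h, t, c) := by
  have hq : binForm k r N h t ≡ binForm k r N (h + r) (t + -(2 * k)) [ZMOD Δ] := by
    refine Int.modEq_iff_dvd.mpr ⟨t - k, ?_⟩
    rw [S.eq, binForm, binForm]
    ring
  have hB : ∀ s₁ s₂, binPolar k r N h t s₁ s₂ ≡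
      binPolar k r N (h + r) (t + -(2 * k)) s₁ s₂ [ZMOD Δ] := fun s₁ s₂ => by
    refine Int.modEq_iff_dvd.mpr ⟨s₂, ?_⟩
    rw [S.eq, binPolar, binPolar]
    ring
  rw [S.genusFun_intCast, S.genusFun_intCast]
  by_cases hac : a * c ≡ binForm k r N h t [ZMOD Δ]
  · rw [if_pos hac, if_pos (hac.trans hq), S.genusChar_congr hac rfl rfl hq hB]
  · rw [if_neg hac, if_neg fun h1 => hac (h1.trans hq.symm)]

lemma exists_eq_intCast {D : ℕ} (v : ZMod D × ZMod D × ZMod D × ZMod D) :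
    ∃ a h t c : ℤ, v = ((a : ZMod D), (h : ZMod D), (t : ZMod D), (c : ZMod D)) := by
  obtain ⟨a, h, t, c⟩ := v
  obtain ⟨a, rfl⟩ := ZMod.intCast_surjective a
  obtain ⟨h, rfl⟩ := ZMod.intCast_surjective h
  obtain ⟨t, rfl⟩ := ZMod.intCast_surjective t
  obtain ⟨c, rfl⟩ := ZMod.intCast_surjective c
  exact ⟨a, h, t, c, rfl⟩

lemma lowerMove_intCast_fst {D : ℕ} (a h t c s₁ s₂ : ℤ) :
    (lowerMove (k : ZMod D) r N s₁ s₂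
      ((a : ZMod D), (h : ZMod D), (t : ZMod D), (c : ZMod D))).1 =
      ((a + binPolar k r N h t s₁ s₂ + c * binForm k r N s₁ s₂ : ℤ) : ZMod D) := by
  simp only [lowerMove, binPolar, binForm]
  push_cast
  rfl

lemma isIsotropicChar (S : IsGenusSetting N Δ r k ψ χ) :
    IsIsotropicChar (k : ZMod Δ.natAbs) r N (zmodFun Δ.natAbs ψ) (genusFun Δ.natAbs N r k χ) where
  supp v hv := if_neg hv
  left v s₁ s₂ hv hu := by
    obtain ⟨a, h, t, c, rfl⟩ := exists_eq_intCast v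
    obtain ⟨s₁, rfl⟩ := ZMod.intCast_surjective s₁
    obtain ⟨s₂, rfl⟩ := ZMod.intCast_surjective s₂
    rw [quatForm_eq_zero_iff] at hv
    rw [lowerMove_intCast_fst] at hu ⊢
    rw [S.genusFun_intCast, if_pos hv, S.char.zmodFun_intCast,
      S.eq_left hv (isUnit_intCast_natAbs_iff.mp hu)]
  right v s₁ s₂ hv hu := by
    obtain ⟨a, h, t, c, rfl⟩ := exists_eq_intCast v
    obtain ⟨s₁, rfl⟩ := ZMod.intCast_surjective s₁
    obtain ⟨s₂, rfl⟩ := ZMod.intCast_surjective s₂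
    rw [quatForm_eq_zero_iff] at hv
    rw [swapMove, lowerMove_intCast_fst] at hu ⊢
    rw [S.genusFun_intCast, if_pos hv, S.char.zmodFun_intCast,
      S.eq_right hv (isUnit_intCast_natAbs_iff.mp hu)]
  exists_left v hv := by
    obtain ⟨a, h, t, c, rfl⟩ := exists_eq_intCast v
    rw [S.genusFun_intCast, ite_ne_right_iff, Int.cast_ne_zero] at hv
    obtain ⟨s₁, s₂, hs⟩ := S.exists_coprime hv.1 fun p hp hpΔ hac =>
      hv.2 (S.eq_zero hv.1 hp hpΔ hac.1 hac.2)
    exact ⟨s₁, s₂, by rwa [lowerMove_intCast_fst, isUnit_intCast_natAbs_iff]⟩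
  exists_right v hv := by
    obtain ⟨a, h, t, c, rfl⟩ := exists_eq_intCast v
    rw [S.genusFun_intCast, ite_ne_right_iff, Int.cast_ne_zero] at hv
    obtain ⟨s₁, s₂, hs⟩ := S.exists_coprime (mul_comm a c ▸ hv.1) fun p hp hpΔ hac =>
      hv.2 (S.eq_zero hv.1 hp hpΔ hac.2 hac.1)
    exact ⟨s₁, s₂, by rwa [swapMove, lowerMove_intCast_fst, isUnit_intCast_natAbs_iff]⟩
  degenerate v hv h0 := by
    obtain ⟨a, h, t, c, rfl⟩ := exists_eq_intCast v
    rw [quatForm_eq_zero_iff] at hv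
    rw [S.genusFun_intCast, if_pos hv, Int.cast_eq_zero] at h0
    have hnd : ∃ p : ℕ, p.Prime ∧ (p : ℤ) ∣ Δ ∧ (p : ℤ) ∣ a ∧ (p : ℤ) ∣ c := by
      by_contra! hnd
      obtain ⟨s₁, s₂, hs⟩ := S.exists_coprime hv fun p hp hpΔ hac => hnd p hp hpΔ hac.1 hac.2
      have h1 := S.char.mul_self hs
      rw [← S.eq_left hv hs, h0] at h1
      exact absurd h1 (by norm_num)
    obtain ⟨p, hp, hpΔ, ha, hc⟩ := hnd
    have hpΔ' := Int.natCast_dvd.mp hpΔ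
    obtain ⟨u, hu1, hu⟩ := S.char.char.prim p hp hpΔ'
    refine ⟨u, S.char.isUnit_of_ne_zero (by simp [hu]), by rw [S.char.zmodFun_intCast, hu]; simp,
      fun w => ?_⟩
    obtain ⟨a', h', t', c', rfl⟩ := exists_eq_intCast w
    have hdvd : (p : ℤ) ∣ binPolar k r N h t h' t' - a * c' - a' * c :=
      dvd_sub (dvd_sub (S.dvd_binPolar hp hpΔ ((dvd_binForm_iff hpΔ hv).mp (ha.mul_right c)) _ _)
        (ha.mul_right _)) (hc.mul_left _)
    have h1 := mul_dvd_mul hu1.symm.dvd hdvd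
    rw [← Int.natCast_mul, Nat.div_mul_cancel hpΔ', ← ZMod.intCast_zmod_eq_zero_iff_dvd] at h1
    rw [← h1, quatPolar, binPolar, binPolar]
    push_cast
    rfl

lemma card_radical_le (S : IsGenusSetting N Δ r k ψ χ) [NeZero Δ.natAbs] :
    (Finset.univ.filter fun w : ZMod Δ.natAbs × ZMod Δ.natAbs × ZMod Δ.natAbs × ZMod Δ.natAbs =>
      ∀ v, quatPolar (k : ZMod Δ.natAbs) r N v w = 0).card ≤ Fintype.card (ZMod Δ.natAbs) := by
  rw [ZMod.card]
  refine le_trans ?_ (card_binForm_radical_le (D := Δ.natAbs) (k := k) (r := r) (N := N) ?_)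
  · have hmem : ∀ w : ZMod Δ.natAbs × ZMod Δ.natAbs × ZMod Δ.natAbs × ZMod Δ.natAbs,
        (∀ v, quatPolar (k : ZMod Δ.natAbs) r N v w = 0) → w.1 = 0 ∧ w.2.2.2 = 0 ∧
          2 * k * w.2.1 + r * w.2.2.1 = 0 ∧ r * w.2.1 + 2 * N * w.2.2.1 = 0 := by
      intro w hw
      have h1 := hw (0, 0, 0, 1)
      have h2 := hw (1, 0, 0, 0)
      have h3 := hw (0, 1, 0, 0)
      have h4 := hw (0, 0, 1, 0)
      simp only [quatPolar, binPolar] at h1 h2 h3 h4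
      refine ⟨?_, ?_, ?_, ?_⟩
      · linear_combination -h1
      · linear_combination -h2
      · linear_combination h3
      · linear_combination h4
    refine Finset.card_le_card_of_injOn (fun w => (w.2.1, w.2.2.1)) ?_ ?_
    · intro w hw
      obtain ⟨-, -, h1, h2⟩ := hmem w (Finset.mem_filter.mp hw).2
      refine Finset.mem_filter.mpr ⟨Finset.mem_univ _, ?_⟩
      push_cast
      exact ⟨h1, h2⟩
    · intro w hw w' hw' heq
      obtain ⟨h1, h2, -⟩ := hmem w (Finset.mem_filter.mp hw).2
      obtain ⟨h1', h2', -⟩ := hmem w' (Finset.mem_filter.mp hw').2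
      simp only [Prod.mk.injEq] at heq
      exact Prod.ext (h1.trans h1'.symm) (Prod.ext heq.1 (Prod.ext heq.2 (h2.trans h2'.symm)))
  · rw [← S.eq]
    exact Int.natAbs_eq Δ |>.imp Eq.symm fun h => by omega

lemma gaussSum_zmod (S : IsGenusSetting N Δ r k ψ χ) [NeZero Δ.natAbs] :
    ∑ x, (zmodFun Δ.natAbs ψ x : ℂ) * ZMod.stdAddChar x =
      (if 0 < Δ then 1 else I) * (Real.sqrt Δ.natAbs : ℂ) := by
  rw [← S.char.gauss, charGaussSum, ← sum_range_eq_sum_zmod]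
  refine Finset.sum_congr rfl fun x _ => ?_
  have h1 := S.char.zmodFun_intCast x
  have h2 := stdAddChar_intCast Δ.natAbs x
  rw [Int.cast_natCast] at h1 h2
  rw [h1, h2]
  push_cast
  rfl

/-- The Fourier transform of the genus character on `(ℤ/Δ)⁴`. -/
theorem fourier_genusFun (S : IsGenusSetting N Δ r k ψ χ) [NeZero Δ.natAbs]
    (v : ZMod Δ.natAbs × ZMod Δ.natAbs × ZMod Δ.natAbs × ZMod Δ.natAbs) :
    quatFourier ZMod.stdAddChar (k : ZMod Δ.natAbs) r N (genusFun Δ.natAbs N r k χ) v =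
      genusFun Δ.natAbs N r k χ v * ((Δ.natAbs : ℂ) ^ 2 *
        ((if 0 < Δ then 1 else I) * (Real.sqrt Δ.natAbs : ℂ))) := by
  rw [S.isIsotropicChar.fourier_eq ZMod.stdAddChar (ZMod.isPrimitive_stdAddChar _)
    S.char.isRealRingChar (by convert S.card_radical_le), S.gaussSum_zmod, ZMod.card]
  rw [S.gaussSum_zmod, Complex.normSq_mul, Complex.normSq_ofReal, Real.mul_self_sqrt (by positivity),
    ZMod.card]
  split_ifs <;> simp

end IsGenusSetting

lemma sum_range_mul_ite {M : ℕ} (hM : 0 < M) (D : ℕ) (g : ℤ → ℂ) :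
    (∑ x ∈ Finset.range (M * D), if (M : ℤ) ∣ x then g x else 0) =
      ∑ t ∈ Finset.range D, g (M * t) := by
  induction D with
  | zero => simp
  | succ D ih =>
    rw [mul_add_one, Finset.sum_range_add, ih, Finset.sum_range_succ]
    congr 1
    rw [Finset.sum_eq_single_of_mem 0 (Finset.mem_range.mpr hM)]
    · simp
    · intro j hj hj0
      rw [if_neg]
      push_cast
      rw [Int.dvd_add_right (dvd_mul_right _ _)]
      intro h
      exact hj0 (Nat.eq_zero_of_dvd_of_lt (by exact_mod_cast h) (Finset.mem_range.mp hj))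

lemma Function.Periodic.sum_range_ite_modEq {M D : ℕ} [NeZero M] [NeZero D] {g : ℤ → ℂ}
    (hg : Function.Periodic g ((M * D : ℕ) : ℤ)) (b : ℤ) :
    (∑ x ∈ Finset.range (M * D), if (x : ℤ) ≡ b [ZMOD M] then g x else 0) =
      ∑ t ∈ Finset.range D, g (b + M * t) := by
  have hg' : Function.Periodic (fun x : ℤ => if x ≡ b [ZMOD M] then g x else 0)
      ((M * D : ℕ) : ℤ) := fun x => by
    have : (x + (M * D : ℕ) ≡ b [ZMOD M]) ↔ (x ≡ b [ZMOD M]) := by simp [Int.ModEq]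
    simp only [this, hg x]
  rw [← hg'.sum_range_add b, ← sum_range_mul_ite (NeZero.pos M) D fun x => g (b + x)]
  refine Finset.sum_congr rfl fun x _ => ?_
  have : ((x : ℤ) + b ≡ b [ZMOD M]) ↔ (M : ℤ) ∣ x := by
    rw [Int.modEq_comm, Int.modEq_iff_dvd]; simp
  simp only [this, add_comm b]

lemma Function.Periodic.sum_range_mul {M : ℕ} {g : ℤ → ℂ} (hg : Function.Periodic g (M : ℤ))
    (D : ℕ) : ∑ x ∈ Finset.range (M * D), g x = D * ∑ x ∈ Finset.range M, g x := by
  induction D with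
  | zero => simp
  | succ D ih =>
    rw [mul_add_one, Finset.sum_range_add, ih]
    have : ∀ x : ℕ, g ((M * D + x : ℕ) : ℤ) = g x := fun x => by
      refine hg.eq_of_intModEq ?_
      simp [Int.ModEq]
    simp only [this]
    push_cast
    ring

lemma sum_range_e_mul {M : ℕ} [NeZero M] (j : ℤ) :
    ∑ x ∈ Finset.range M, e ((x * j : ℂ) / M) = if (M : ℤ) ∣ j then (M : ℂ) else 0 := by
  have h := AddChar.sum_mulShift (j : ZMod M) (ZMod.isPrimitive_stdAddChar M)
  rw [ZMod.card, ← sum_range_eq_sum_zmod,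
    if_congr (ZMod.intCast_zmod_eq_zero_iff_dvd j M) rfl rfl] at h
  rw [Nat.cast_ite, Nat.cast_zero] at h
  rw [← h]
  refine Finset.sum_congr rfl fun x _ => ?_
  have := stdAddChar_intCast M (x * j)
  push_cast at this
  exact this.symm

lemma e_div_eq_one_iff {M : ℕ} [NeZero M] (j : ℤ) : e ((j : ℂ) / M) = 1 ↔ (M : ℤ) ∣ j := by
  rw [← stdAddChar_intCast, ← AddChar.map_zero_eq_one (ZMod.stdAddChar (N := M)),
    ZMod.injective_stdAddChar.eq_iff, ZMod.intCast_zmod_eq_zero_iff_dvd]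

/-- Inversion of the finite Fourier transform. -/
lemma Function.Periodic.sum_range_fourier_inversion {M : ℕ} [NeZero M] {G : ℤ → ℂ}
    (hG : Function.Periodic G (M : ℤ)) {σ : ℤ} (hσ : IsUnit σ) (h : ℤ) :
    ∑ y ∈ Finset.range M, (∑ x ∈ Finset.range M, G x * e ((σ * x * y : ℂ) / M)) *
      e ((-σ * h * y : ℂ) / M) = M * G h := by
  simp only [Finset.sum_mul]
  rw [Finset.sum_comm]
  have h1 : ∀ x ∈ Finset.range M, ∑ y ∈ Finset.range M,
      G x * e ((σ * x * y : ℂ) / M) * e ((-σ * h * y : ℂ) / M) =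
        if (x : ℤ) ≡ h [ZMOD M] then M * G x else 0 := by
    intro x _
    have h2 : ((x : ℤ) ≡ h [ZMOD M]) ↔ (M : ℤ) ∣ σ * (x - h) := by
      rw [Int.modEq_comm, Int.modEq_iff_dvd, hσ.dvd_mul_left]
    rw [if_congr h2 rfl rfl]
    have h3 := sum_range_e_mul (M := M) (σ * (x - h))
    have h4 : ∀ y : ℕ, G x * e ((σ * x * y : ℂ) / M) * e ((-σ * h * y : ℂ) / M) =
        G x * e ((y * (σ * (x - h) : ℤ) : ℂ) / M) := fun y => by
      rw [mul_assoc, ← e_add]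
      congr 2
      push_cast
      ring
    simp only [h4, ← Finset.mul_sum, h3]
    split_ifs
    · ring
    · ring
  rw [Finset.sum_congr rfl h1]
  have h5 := Function.Periodic.sum_range_ite_modEq (M := M) (D := 1) (g := fun x => M * G x)
    (fun x => by simp [hG x]) h
  simpa using h5

/-- The exponential sum `G_h(λ, Δ, r)` at `λ = (a, b, c)`. -/
def twistedSum (N : ℕ) (Δ r : ℤ) (χ : ℤ → ℤ → ℤ → ℤ) (a b c h : ℤ) : ℂ :=
  ∑ a' ∈ Finset.range Δ.natAbs, ∑ b' ∈ Finset.range (2 * N * Δ.natAbs),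
    ∑ c' ∈ Finset.range Δ.natAbs,
      if (b' : ℤ) ≡ r * h [ZMOD (2 * (N : ℤ))] ∧
          QD N (a' : ℤ) (b' : ℤ) (c' : ℤ) ≡ Δ * h ^ 2 [ZMOD (4 * (N : ℤ) * Δ)] then
        (χ (a' : ℤ) (b' : ℤ) (c' : ℤ) : ℂ) *
          e (-((b : ℂ) * (b' : ℂ) / (2 * (N : ℂ)) -
                ((a : ℂ) * (c' : ℂ) + (a' : ℂ) * (c : ℂ))) / (Δ.natAbs : ℂ))
      else 0

/-- The part of the exponential sum over the hyperbolic plane. -/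
def hyperbolicSum (D N : ℕ) (r k : ℤ) (χ : ℤ → ℤ → ℤ → ℤ) (a c h t : ℤ) : ℂ :=
  ∑ a' ∈ Finset.range D, ∑ c' ∈ Finset.range D,
    (genusFun D N r k χ (a', h, t, c') : ℂ) * e (((a * c' + a' * c : ℤ) : ℂ) / D)

lemma hyperbolicSum_congr {D N : ℕ} {r k : ℤ} {χ : ℤ → ℤ → ℤ → ℤ} {a c h t h' t' : ℤ}
    (hh : h ≡ h' [ZMOD D]) (ht : t ≡ t' [ZMOD D]) :
    hyperbolicSum D N r k χ a c h t = hyperbolicSum D N r k χ a c h' t' := by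
  rw [hyperbolicSum, (ZMod.intCast_eq_intCast_iff _ _ _).mpr hh,
    (ZMod.intCast_eq_intCast_iff _ _ _).mpr ht, hyperbolicSum]

lemma e_div_congr {M : ℕ} [NeZero M] {x y : ℤ} (h : x ≡ y [ZMOD M]) :
    e ((x : ℂ) / M) = e ((y : ℂ) / M) := by
  rw [← stdAddChar_intCast, ← stdAddChar_intCast, (ZMod.intCast_eq_intCast_iff _ _ _).mpr h]

lemma twistedSum_periodic (N : ℕ) (Δ r : ℤ) (χ : ℤ → ℤ → ℤ → ℤ) (a b c : ℤ) :
    Function.Periodic (twistedSum N Δ r χ a b c) ((2 * N : ℕ) : ℤ) := fun h => by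
  have h1 : r * (h + (2 * N : ℕ)) ≡ r * h [ZMOD (2 * (N : ℤ))] :=
    (Int.modEq_iff_dvd.mpr ⟨-r, by push_cast; ring⟩)
  have h2 : Δ * (h + (2 * N : ℕ)) ^ 2 ≡ Δ * h ^ 2 [ZMOD (4 * (N : ℤ) * Δ)] :=
    (Int.modEq_iff_dvd.mpr ⟨-(h + N), by push_cast; ring⟩)
  have h3 : ∀ x : ℤ, x ≡ r * (h + (2 * N : ℕ)) [ZMOD (2 * (N : ℤ))] ↔
      x ≡ r * h [ZMOD (2 * (N : ℤ))] := fun x => ⟨fun y => y.trans h1, fun y => y.trans h1.symm⟩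
  have h4 : ∀ x : ℤ, x ≡ Δ * (h + (2 * N : ℕ)) ^ 2 [ZMOD (4 * (N : ℤ) * Δ)] ↔
      x ≡ Δ * h ^ 2 [ZMOD (4 * (N : ℤ) * Δ)] :=
    fun x => ⟨fun y => y.trans h2, fun y => y.trans h2.symm⟩
  simp only [twistedSum, h3, h4]

namespace IsGenusSetting
variable {N : ℕ} {Δ r k : ℤ} {ψ : ℤ → ℤ} {χ : ℤ → ℤ → ℤ → ℤ} {a b c h t : ℤ}

lemma QD_modEq_iff (S : IsGenusSetting N Δ r k ψ χ) (a h t c : ℤ) :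
    QD N a (r * h + 2 * N * t) c ≡ Δ * h ^ 2 [ZMOD (4 * (N : ℤ) * Δ)] ↔
      a * c ≡ binForm k r N h t [ZMOD Δ] := by
  have hN : (4 * (N : ℤ)) ≠ 0 := by have := S.pos; positivity
  rw [Int.modEq_comm, Int.modEq_iff_dvd, Int.modEq_iff_dvd,
    show QD N a (r * h + 2 * N * t) c - Δ * h ^ 2 = 4 * N * (binForm k r N h t - a * c) by
      rw [S.eq, QD, binForm]; ring, mul_dvd_mul_iff_left hN]

lemma neZero (S : IsGenusSetting N Δ r k ψ χ) : NeZero Δ.natAbs :=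
  ⟨Int.natAbs_ne_zero.mpr S.disc.ne_zero⟩

lemma twistedSum_eq (S : IsGenusSetting N Δ r k ψ χ) (a b c h : ℤ) :
    twistedSum N Δ r χ a b c h = ∑ t ∈ Finset.range Δ.natAbs,
      hyperbolicSum Δ.natAbs N r k χ a c h t *
        e (((-b * (r * h + 2 * N * t) : ℤ) : ℂ) / (2 * N * Δ.natAbs : ℕ)) := by
  have := S.neZero
  have hD0 : ((Δ.natAbs : ℕ) : ℂ) ≠ 0 := NeZero.ne _
  have hN0 : (N : ℂ) ≠ 0 := Nat.cast_ne_zero.mpr S.pos.ne'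
  have : NeZero (2 * N) := ⟨by have := S.pos; omega⟩
  simp only [hyperbolicSum, Finset.sum_mul]
  rw [twistedSum, Finset.sum_comm (s := Finset.range Δ.natAbs)]
  conv_rhs => rw [Finset.sum_comm]
  rw [Finset.sum_comm]
  refine Finset.sum_congr rfl fun a' _ => ?_
  rw [Finset.sum_comm]
  conv_rhs => rw [Finset.sum_comm]
  refine Finset.sum_congr rfl fun c' _ => ?_
  set g : ℤ → ℂ := fun x =>
    if QD N (a' : ℤ) x (c' : ℤ) ≡ Δ * h ^ 2 [ZMOD (4 * (N : ℤ) * Δ)] then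
      (χ a' x c' : ℂ) * (e (((-b * x : ℤ) : ℂ) / (2 * N * Δ.natAbs : ℕ)) *
        e (((a * c' + a' * c : ℤ) : ℂ) / Δ.natAbs))
    else 0 with hg
  obtain ⟨u, hu⟩ : Δ ∣ |Δ| := self_dvd_abs Δ
  have hper : Function.Periodic g ((2 * N * Δ.natAbs : ℕ) : ℤ) := fun x => by
    have h1 : QD N (a' : ℤ) (x + (2 * N * Δ.natAbs : ℕ)) (c' : ℤ) ≡ QD N (a' : ℤ) x (c' : ℤ)
        [ZMOD (4 * (N : ℤ) * Δ)] := by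
      refine Int.modEq_iff_dvd.mpr ⟨-(u * (x + N * |Δ|)), ?_⟩
      rw [QD, QD]
      push_cast
      linear_combination (-4 * N * x - 4 * N ^ 2 * |Δ|) * hu
    have h2 : χ a' (x + (2 * N * Δ.natAbs : ℕ)) c' = χ a' x c' :=
      S.genus.1 _ _ _ _ _ _ rfl (Int.modEq_iff_dvd.mpr ⟨-u, by push_cast; rw [hu]; ring⟩) rfl
    have h3 : e (((-b * (x + (2 * N * Δ.natAbs : ℕ)) : ℤ) : ℂ) / (2 * N * Δ.natAbs : ℕ)) =
        e (((-b * x : ℤ) : ℂ) / (2 * N * Δ.natAbs : ℕ)) := by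
      refine e_div_congr (Int.modEq_iff_dvd.mpr ⟨b, by ring⟩)
    have h4 : (QD N (a' : ℤ) (x + (2 * N * Δ.natAbs : ℕ)) (c' : ℤ) ≡ Δ * h ^ 2
        [ZMOD (4 * (N : ℤ) * Δ)]) ↔ (QD N (a' : ℤ) x (c' : ℤ) ≡ Δ * h ^ 2
        [ZMOD (4 * (N : ℤ) * Δ)]) := ⟨fun y => h1.symm.trans y, fun y => h1.trans y⟩
    simp only [hg, h2, h3, h4]
  have hsum := hper.sum_range_ite_modEq (M := 2 * N) (D := Δ.natAbs) (r * h)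
  calc _ = ∑ x ∈ Finset.range (2 * N * Δ.natAbs),
        if (x : ℤ) ≡ r * h [ZMOD (2 * N : ℕ)] then g x else 0 := by
        refine Finset.sum_congr rfl fun x _ => ?_
        rw [ite_and]
        push_cast
        refine if_congr Iff.rfl ?_ rfl
        simp only [hg]
        refine if_congr Iff.rfl ?_ rfl
        rw [← e_add]
        congr 2
        push_cast
        field_simp
        ring
    _ = _ := by
        rw [hsum]
        refine Finset.sum_congr rfl fun t _ => ?_
        have h1 := S.genusFun_intCast a' h t c'
        push_cast at h1
        simp only [hg]
        push_cast
        rw [h1, if_congr (S.QD_modEq_iff _ _ _ _) rfl rfl]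
        split_ifs
        · push_cast
          ring
        · simp

lemma hyperbolicSum_shift (S : IsGenusSetting N Δ r k ψ χ) (a c h t : ℤ) :
    hyperbolicSum Δ.natAbs N r k χ a c (h + r) (t + -(2 * k)) =
      hyperbolicSum Δ.natAbs N r k χ a c h t := by
  refine Finset.sum_congr rfl fun a' _ => Finset.sum_congr rfl fun c' _ => ?_
  have := S.genusFun_shift a' h t c'
  push_cast at this ⊢
  rw [this]

end IsGenusSetting

/-- The summand of the Fourier transform of `twistedSum` in the variable `h`. -/
def fourierTerm (N : ℕ) (Δ r k : ℤ) (χ : ℤ → ℤ → ℤ → ℤ) (a b c h' h t : ℤ) : ℂ :=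
  hyperbolicSum Δ.natAbs N r k χ a c h t *
    e (((-b * (r * h + 2 * N * t) + Δ * h * h' : ℤ) : ℂ) / (2 * N * Δ.natAbs : ℕ))

lemma isUnit_sign {Δ : ℤ} (hΔ : Δ ≠ 0) : IsUnit Δ.sign :=
  Int.isUnit_iff_natAbs_eq.mpr (Int.natAbs_sign_of_ne_zero hΔ)

lemma sign_div_eq {Δ : ℤ} (hΔ : Δ ≠ 0) (N : ℕ) (z : ℂ) :
    (Δ.sign : ℂ) * z / (2 * N : ℕ) = Δ * z / (2 * N * Δ.natAbs : ℕ) := by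
  have hD0 : ((Δ.natAbs : ℕ) : ℂ) ≠ 0 := Nat.cast_ne_zero.mpr (Int.natAbs_ne_zero.mpr hΔ)
  have h1 : (Δ : ℂ) = Δ.sign * Δ.natAbs := by
    rw [← Int.cast_natCast, ← Int.cast_mul, Int.sign_mul_natAbs]
  rw [Nat.cast_mul (2 * N), ← mul_div_mul_right _ _ hD0, h1]
  ring_nf

namespace IsGenusSetting
variable {N : ℕ} {Δ r k : ℤ} {ψ : ℤ → ℤ} {χ : ℤ → ℤ → ℤ → ℤ} {a b c h t : ℤ}

lemma fourierTerm_periodic_left (S : IsGenusSetting N Δ r k ψ χ) (a b c h' t : ℤ) :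
    Function.Periodic (fun h => fourierTerm N Δ r k χ a b c h' h t)
      ((2 * N * Δ.natAbs : ℕ) : ℤ) := fun h => by
  have := S.neZero
  have : NeZero (2 * N * Δ.natAbs) := ⟨by have := S.pos; have := NeZero.ne Δ.natAbs; positivity⟩
  change fourierTerm _ _ _ _ _ _ _ _ _ _ _ = fourierTerm _ _ _ _ _ _ _ _ _ _ _
  rw [fourierTerm, fourierTerm, hyperbolicSum_congr (h' := h) (t' := t)
    (Int.modEq_iff_dvd.mpr ⟨-(2 * N), by push_cast; ring⟩) rfl]
  congr 1
  exact e_div_congr (Int.modEq_iff_dvd.mpr ⟨b * r - Δ * h', by ring⟩)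

lemma fourierTerm_periodic_right (S : IsGenusSetting N Δ r k ψ χ) (a b c h' h : ℤ) :
    Function.Periodic (fun t => fourierTerm N Δ r k χ a b c h' h t)
      ((Δ.natAbs : ℕ) : ℤ) := fun t => by
  have := S.neZero
  have : NeZero (2 * N * Δ.natAbs) := ⟨by have := S.pos; have := NeZero.ne Δ.natAbs; positivity⟩
  change fourierTerm _ _ _ _ _ _ _ _ _ _ _ = fourierTerm _ _ _ _ _ _ _ _ _ _ _
  rw [fourierTerm, fourierTerm, hyperbolicSum_congr (h' := h) (t' := t) rfl
    (Int.modEq_iff_dvd.mpr ⟨-1, by ring⟩)]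
  congr 1
  exact e_div_congr (Int.modEq_iff_dvd.mpr ⟨b, by push_cast; ring⟩)

lemma fourierTerm_shift (S : IsGenusSetting N Δ r k ψ χ) (a b c h' h t : ℤ) :
    fourierTerm N Δ r k χ a b c h' (h + r) (t + -(2 * k)) =
      e (((-(Δ.sign * (b - r * h')) : ℤ) : ℂ) / (2 * N : ℕ)) *
        fourierTerm N Δ r k χ a b c h' h t := by
  have hs := sign_div_eq S.disc.ne_zero N (-(b - r * h'))
  have hs' : (((-(Δ.sign * (b - r * h')) : ℤ) : ℂ) / (2 * N : ℕ)) =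
    Δ * (-(b - r * h')) / (2 * N * Δ.natAbs : ℕ) := by
      rw [← hs]; push_cast; ring
  rw [fourierTerm, fourierTerm, S.hyperbolicSum_shift, mul_left_comm, ← e_add, hs', ← add_div]
  congr 3
  have h1 : -b * (r * (h + r) + 2 * N * (t + -(2 * k))) + Δ * (h + r) * h' =
      Δ * (-(b - r * h')) + (-b * (r * h + 2 * N * t) + Δ * h * h') := by
    linear_combination b * S.eq
  exact_mod_cast h1

lemma sum_fourierTerm_eq_zero (S : IsGenusSetting N Δ r k ψ χ) (a : ℤ) {b : ℤ} (c : ℤ) {h' : ℤ}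
    (hb : ¬ b ≡ r * h' [ZMOD (2 * (N : ℤ))]) :
    ∑ h ∈ Finset.range (2 * N * Δ.natAbs), ∑ t ∈ Finset.range Δ.natAbs,
      fourierTerm N Δ r k χ a b c h' h t = 0 := by
  have := S.neZero
  have h2N : NeZero (2 * N) := ⟨by have := S.pos; omega⟩
  have : NeZero (2 * N * Δ.natAbs) := ⟨mul_ne_zero (NeZero.ne _) (NeZero.ne _)⟩
  set T := ∑ h ∈ Finset.range (2 * N * Δ.natAbs), ∑ t ∈ Finset.range Δ.natAbs,
    fourierTerm N Δ r k χ a b c h' h t with hT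
  set ζ := e (((-(Δ.sign * (b - r * h')) : ℤ) : ℂ) / (2 * N : ℕ)) with hζ
  have h1 : ζ ≠ 1 := fun h => hb <| by
    rw [hζ, e_div_eq_one_iff, dvd_neg, (isUnit_sign S.disc.ne_zero).dvd_mul_left] at h
    exact (Int.modEq_iff_dvd.mpr (by exact_mod_cast h)).symm
  have h2 : T = ζ * T := by
    have hper : Function.Periodic (fun h : ℤ => ∑ t ∈ Finset.range Δ.natAbs,
        fourierTerm N Δ r k χ a b c h' h t) ((2 * N * Δ.natAbs : ℕ) : ℤ) := fun h =>
      Finset.sum_congr rfl fun t _ => S.fourierTerm_periodic_left a b c h' t h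
    rw [hT, Finset.mul_sum, ← hper.sum_range_add r]
    refine Finset.sum_congr rfl fun h _ => ?_
    rw [← (S.fourierTerm_periodic_right a b c h' (h + r)).sum_range_add (-(2 * k)), Finset.mul_sum]
    exact Finset.sum_congr rfl fun t _ => S.fourierTerm_shift a b c h' h t
  have h3 : (1 - ζ) * T = 0 := by linear_combination h2
  exact (mul_eq_zero.mp h3).resolve_left (sub_ne_zero.mpr h1.symm)

lemma fourierTerm_of_eq (S : IsGenusSetting N Δ r k ψ χ) [NeZero Δ.natAbs]
    (a c h' t' h t : ℤ) :
    fourierTerm N Δ r k χ a (r * h' + 2 * N * t') c h' h t =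
      ∑ a' ∈ Finset.range Δ.natAbs, ∑ c' ∈ Finset.range Δ.natAbs,
        (genusFun Δ.natAbs N r k χ (a', h, t, c') : ℂ) *
          ZMod.stdAddChar (-quatPolar (k : ZMod Δ.natAbs) r N (a, h', t', c) (a', h, t, c')) := by
  have hD0 : ((Δ.natAbs : ℕ) : ℂ) ≠ 0 := NeZero.ne _
  have hN0 : (N : ℂ) ≠ 0 := Nat.cast_ne_zero.mpr S.pos.ne'
  rw [fourierTerm, hyperbolicSum, Finset.sum_mul]
  refine Finset.sum_congr rfl fun a' _ => ?_
  rw [Finset.sum_mul]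
  refine Finset.sum_congr rfl fun c' _ => ?_
  rw [mul_assoc, ← e_add]
  congr 1
  have h1 : -(r * h' + 2 * N * t') * (r * h + 2 * N * t) + Δ * h * h' =
      2 * N * -binPolar k r N h' t' h t := by
    rw [S.eq, binPolar]; ring
  have h2 : -quatPolar (k : ZMod Δ.natAbs) r N (a, h', t', c) (a', h, t, c') =
      ((-binPolar k r N h' t' h t + (a * c' + a' * c) : ℤ) : ZMod Δ.natAbs) := by
    simp only [quatPolar, binPolar]
    push_cast
    ring
  rw [h1, h2, stdAddChar_intCast]
  congr 1
  push_cast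
  field_simp
  ring

lemma sum_fourierTerm_eq (S : IsGenusSetting N Δ r k ψ χ) (a c h' t' : ℤ) :
    ∑ h ∈ Finset.range (2 * N * Δ.natAbs), ∑ t ∈ Finset.range Δ.natAbs,
      fourierTerm N Δ r k χ a (r * h' + 2 * N * t') c h' h t =
      2 * N * ((genusFun Δ.natAbs N r k χ (a, h', t', c) : ℂ) *
        ((Δ.natAbs : ℂ) ^ 2 * ((if 0 < Δ then 1 else I) * (Real.sqrt Δ.natAbs : ℂ)))) := by
  have := S.neZero
  rw [← S.fourier_genusFun]
  have hper : Function.Periodic (fun h : ℤ => ∑ t ∈ Finset.range Δ.natAbs,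
      fourierTerm N Δ r k χ a (r * h' + 2 * N * t') c h' h t) ((Δ.natAbs : ℕ) : ℤ) := fun h => by
    have : ((h + Δ.natAbs : ℤ) : ZMod Δ.natAbs) = h := by
      rw [Int.cast_add, Int.cast_natCast, ZMod.natCast_self, add_zero]
    simp only [S.fourierTerm_of_eq, this]
  have h1 := hper.sum_range_mul (2 * N)
  rw [mul_comm (2 * N), h1, quatFourier]
  push_cast
  congr 1
  simp only [S.fourierTerm_of_eq, Fintype.sum_prod_type]
  simp only [Int.cast_natCast, ← sum_range_eq_sum_zmod]
  conv_rhs => rw [Finset.sum_comm]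
  refine Finset.sum_congr rfl fun h _ => ?_
  conv_rhs => rw [Finset.sum_comm]

end IsGenusSetting

namespace IsGenusSetting
variable {N : ℕ} {Δ r k : ℤ} {ψ : ℤ → ℤ} {χ : ℤ → ℤ → ℤ → ℤ} {a b c h t : ℤ}

lemma sum_fourierTerm (S : IsGenusSetting N Δ r k ψ χ) (a b c h' : ℤ) :
    ∑ h ∈ Finset.range (2 * N * Δ.natAbs), ∑ t ∈ Finset.range Δ.natAbs,
      fourierTerm N Δ r k χ a b c h' h t =
      Δ.natAbs * ∑ h ∈ Finset.range (2 * N), twistedSum N Δ r χ a b c h *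
        e ((Δ.sign * (h : ℤ) * h' : ℂ) / (2 * N : ℕ)) := by
  have : NeZero (2 * N) := ⟨by have := S.pos; omega⟩
  have hper : Function.Periodic (fun h : ℤ => twistedSum N Δ r χ a b c h *
      e ((Δ.sign * h * h' : ℂ) / (2 * N : ℕ))) ((2 * N : ℕ) : ℤ) := fun h => by
    change twistedSum N Δ r χ a b c (h + (2 * N : ℕ)) * _ = _
    rw [twistedSum_periodic]
    congr 1
    have := e_div_congr (M := 2 * N) (x := Δ.sign * (h + (2 * N : ℕ)) * h')
      (y := Δ.sign * h * h') (Int.modEq_iff_dvd.mpr ⟨-(Δ.sign * h'), by ring⟩)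
    push_cast at this ⊢
    exact this
  rw [← hper.sum_range_mul]
  refine Finset.sum_congr rfl fun h _ => ?_
  rw [S.twistedSum_eq, Finset.sum_mul]
  refine Finset.sum_congr rfl fun t _ => ?_
  rw [fourierTerm, mul_assoc (Δ.sign : ℂ), mul_assoc (hyperbolicSum ..), ← e_add, sign_div_eq S.disc.ne_zero,
    ← add_div]
  congr 3
  push_cast
  ring

lemma fourier_twistedSum (S : IsGenusSetting N Δ r k ψ χ) (a b c h' : ℤ) :
    ∑ h ∈ Finset.range (2 * N), twistedSum N Δ r χ a b c h *
        e ((Δ.sign * (h : ℤ) * h' : ℂ) / (2 * N : ℕ)) =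
      2 * N * if b ≡ r * h' [ZMOD (2 * (N : ℤ))] ∧
            QD N a b c ≡ Δ * h' ^ 2 [ZMOD (4 * (N : ℤ) * Δ)] then
          (if 0 < Δ then 1 else I) * (Real.sqrt Δ.natAbs : ℂ) ^ 3 * (χ a b c : ℂ) else 0 := by
  have := S.neZero
  refine mul_left_cancel₀ (NeZero.ne (Δ.natAbs : ℂ)) ?_
  rw [← S.sum_fourierTerm]
  by_cases hb : b ≡ r * h' [ZMOD (2 * (N : ℤ))]
  · obtain ⟨t', ht'⟩ := hb.symm.dvd
    obtain rfl : b = r * h' + 2 * N * t' := by linear_combination ht'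
    rw [S.sum_fourierTerm_eq, S.genusFun_intCast]
    have h1 : (Real.sqrt Δ.natAbs : ℂ) ^ 2 = Δ.natAbs := by
      rw [← Complex.ofReal_pow, Real.sq_sqrt (Nat.cast_nonneg _), Complex.ofReal_natCast]
    rw [if_congr ((and_iff_right hb).trans (S.QD_modEq_iff a h' t' c)) rfl rfl]
    by_cases hac : a * c ≡ binForm k r N h' t' [ZMOD Δ]
    · rw [if_pos hac, if_pos hac, ← h1]
      simp only [Complex.ofReal_intCast]
      ring
    · rw [if_neg hac, if_neg hac]
      simp
  · rw [S.sum_fourierTerm_eq_zero a c hb, if_neg fun h => hb h.1]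
    simp

lemma twistedSum_eq_sum (S : IsGenusSetting N Δ r k ψ χ) (a b c h : ℤ) :
    twistedSum N Δ r χ a b c h =
      (if 0 < Δ then 1 else I) * (Real.sqrt Δ.natAbs : ℂ) ^ 3 * (χ a b c : ℂ) *
        ∑ h' ∈ Finset.range (2 * N),
          if b ≡ r * (h' : ℤ) [ZMOD (2 * (N : ℤ))] ∧
              QD N a b c ≡ Δ * (h' : ℤ) ^ 2 [ZMOD (4 * (N : ℤ) * Δ)] then
            e (-(Δ.sign : ℂ) * (h : ℂ) * (h' : ℂ) / (2 * (N : ℂ)))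
          else 0 := by
  have : NeZero (2 * N) := ⟨by have := S.pos; omega⟩
  refine mul_left_cancel₀ (NeZero.ne ((2 * N : ℕ) : ℂ)) ?_
  rw [← (twistedSum_periodic N Δ r χ a b c).sum_range_fourier_inversion
    (isUnit_sign S.disc.ne_zero) h, Finset.mul_sum, Finset.mul_sum]
  refine Finset.sum_congr rfl fun h' _ => ?_
  have h1 := S.fourier_twistedSum a b c h'
  simp only [Int.cast_natCast] at h1
  rw [h1]
  push_cast
  split_ifs <;> ring

end IsGenusSetting

/-- Bruinier–Ono, Proposition 4.2: Let `Δ` be a fundamental discriminant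
and `r ∈ ℤ` with `Δ ≡ r² (mod 4N)`.  For `h ∈ L'/L` and `λ ∈ L'/ΔL` (coordinates:
`h ∈ ℤ` a representative of the class in `L'/L ≅ ℤ/2Nℤ`, `λ = (a, b, c)` corresponding
to the form `[a, b, Nc]`, and `L'/ΔL` parametrized by
`a' ∈ ℤ/Δ`, `b' ∈ ℤ/2NΔ`, `c' ∈ ℤ/Δ` with pairing `(λ, λ') = bb'/2N - (ac' + a'c)`),
the exponential sum
`G_h(λ, Δ, r) = ∑_{λ' ∈ L'/ΔL, λ' ≡ rh (L), Q(λ') ≡ ΔQ(h) (Δ)} χ_Δ(λ') e(-(λ,λ')/|Δ|)`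
equals
`ε |Δ|^{3/2} χ_Δ(λ) ∑_{h' ∈ L'/L, λ ≡ rh' (L), Q(λ) ≡ ΔQ(h') (Δ)} e(-sgn(Δ)(h,h'))`,
where `ε = 1` if `Δ > 0` and `ε = i` if `Δ < 0`. -/
theorem twisted_gauss_sum
    (N : ℕ) (hN : 0 < N) (Δ : ℤ) (hΔ : IsFundamentalDiscriminant Δ)
    (r : ℤ) (hr : Δ ≡ r ^ 2 [ZMOD (4 * (N : ℤ))])
    (χ : ℤ → ℤ → ℤ → ℤ) (hχ : IsGenusChar N Δ χ)
    (h a b c : ℤ) :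
    (∑ a' ∈ Finset.range Δ.natAbs, ∑ b' ∈ Finset.range (2 * N * Δ.natAbs),
      ∑ c' ∈ Finset.range Δ.natAbs,
        if (b' : ℤ) ≡ r * h [ZMOD (2 * (N : ℤ))] ∧
            QD N (a' : ℤ) (b' : ℤ) (c' : ℤ) ≡ Δ * h ^ 2 [ZMOD (4 * (N : ℤ) * Δ)] then
          (χ (a' : ℤ) (b' : ℤ) (c' : ℤ) : ℂ) *
            e (-((b : ℂ) * (b' : ℂ) / (2 * (N : ℂ)) -
                  ((a : ℂ) * (c' : ℂ) + (a' : ℂ) * (c : ℂ))) / (Δ.natAbs : ℂ))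
        else 0) =
    (if 0 < Δ then 1 else Complex.I) * (Real.sqrt (Δ.natAbs) : ℂ) ^ 3 * (χ a b c : ℂ) *
      ∑ h' ∈ Finset.range (2 * N),
        if b ≡ r * (h' : ℤ) [ZMOD (2 * (N : ℤ))] ∧
            QD N a b c ≡ Δ * (h' : ℤ) ^ 2 [ZMOD (4 * (N : ℤ) * Δ)] then
          e (-(Δ.sign : ℂ) * (h : ℂ) * (h' : ℂ) / (2 * (N : ℂ)))
        else 0 := by
  obtain ⟨k, hk⟩ := hr.dvd
  obtain ⟨ψ, hψ⟩ := hΔ.exists_char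
  have S : IsGenusSetting N Δ r k ψ χ := ⟨hN, hΔ, by linear_combination -hk, hψ, hχ⟩
  exact S.twistedSum_eq_sum a b c h
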